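/- arXiv:2310.17850 — 3 statements merged into one kernel-verified Lean document; each statement's English description precedes it below -/
import Mathlib

section
/- Let γ=((a,b),(c,d)) ∈ SL₂(ℤ) with c>0 and content ℓ_γ := gcd(c,a−1) > 1, let x=(x₁,0) ∈ ℚ² with x₁ ∈ ℓ_γ⁻¹ℤ ∖ ℤ, and let ω=(ω₁,ω₂) ∈ ℝ² have entries linearly independent over ℚ; set τ := ω₂/ω₁. Then 𝔷₀(γ)(x,ω) − 𝔷₀(γ)(ℓ_γ·x, ℓ_γ⁻¹·ω) = #(ℤ² ∩ int T_{γ,x}) + (1/2)·#(ℤ² ∩ ∂T_{γ,x}) − area(T_{γ,x}) + (sgn(a+cτ)−3)/4, where int and ∂ denote topological interior and boundary in ℝ². -/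
open scoped Pointwise Classical
open MeasureTheory

/-- Periodic Bernoulli function `B̄₁`. -/
noncomputable def B1 (y : ℝ) : ℝ := if ∃ n : ℤ, (n : ℝ) = y then 0 else Int.fract y - 1 / 2

/-- Periodic Bernoulli function `B̄₂`. -/
noncomputable def B2 (y : ℝ) : ℝ := Int.fract y ^ 2 - Int.fract y + 1 / 6

/-- Dedekind–Rademacher sum `S(a,c;x)`. -/
noncomputable def DR (a c : ℤ) (x₁ x₂ : ℝ) : ℝ :=
  ∑ m ∈ Finset.range c.natAbs, B1 (x₁ + (x₂ + m) * a / c) * B1 ((x₂ + m) / c)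

/-- Indicator function of `ℤ ⊆ ℚ`. -/
def indZ (q : ℚ) : ℝ := if q.den = 1 then 1 else 0

/-- The cocycle `𝔷₀(γ)(x, ω)` for `γ` with entries `a, b, c, d` and `c ≠ 0`;
only `a` and `c` enter the formula. -/
noncomputable def Z0 (a c : ℤ) (x₁ x₂ : ℚ) (ω₁ ω₂ : ℝ) : ℝ :=
  (Int.gcd a c : ℝ) ^ 2 / (2 * c * ((a : ℝ) + c * (ω₂ / ω₁))) *
      B2 (((c : ℝ) / (Int.gcd a c : ℝ)) * (x₁ : ℝ) - ((a : ℝ) / (Int.gcd a c : ℝ)) * (x₂ : ℝ))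
    + ((a : ℝ) + c * (ω₂ / ω₁)) / (2 * c) * B2 (x₂ : ℝ)
    + Real.sign (c : ℝ) * DR (-a) c (x₁ : ℝ) (x₂ : ℝ)
    - Real.sign ((c : ℝ) * ((a : ℝ) + c * (ω₂ / ω₁))) / 4 * indZ x₁ * indZ x₂

/-- The closed triangle `T_γ` in `ℝ²` with vertices `(0,0)`, `(a−1,c)`, `(−1,0)`. -/
def Tri (a c : ℤ) : Set (ℝ × ℝ) :=
  convexHull ℝ {((0 : ℝ), (0 : ℝ)), (((a : ℝ) - 1), (c : ℝ)), ((-1 : ℝ), (0 : ℝ))}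

/-- Number of integral points in a subset of `ℝ²`. -/
noncomputable def latticeCount (S : Set (ℝ × ℝ)) : ℕ :=
  Set.ncard {p : ℤ × ℤ | ((p.1 : ℝ), (p.2 : ℝ)) ∈ S}

/-- The `0`th Ehrhart coefficient `G₀(ℓ⁻¹ T_σ, m)` of the dilated triangle `ℓ⁻¹ T_σ`,
obtained by subtracting the second and first Ehrhart coefficient terms from the
lattice point count of `(m/ℓ)·T_σ`. -/
noncomputable def G0 (aσ cσ : ℤ) (ℓσ ℓ : ℕ) (m : ℕ) : ℝ :=
  (latticeCount (((m : ℝ) / (ℓ : ℝ)) • Tri aσ cσ) : ℝ)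
    - (cσ : ℝ) / (2 * (ℓ : ℝ) ^ 2) * (m : ℝ) ^ 2
    - ((ℓσ : ℝ) + 2) / (2 * (ℓ : ℝ)) * (m : ℝ)


lemma B1_eq (y : ℝ) : B1 y = y - ((⌊y⌋ : ℝ) + ⌈y⌉) / 2 := by
  unfold B1
  split_ifs with h
  · obtain ⟨n, rfl⟩ := h
    simp
  · have h2 : Int.fract y ≠ 0 := by
      intro h0
      exact h ⟨⌊y⌋, by have := Int.floor_add_fract y; rw [h0] at this; linarith⟩
    have h3 : (⌈y⌉ : ℝ) = ⌊y⌋ + 1 := by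
      have := Int.ceil_eq_add_one_sub_fract h2
      have h5 := Int.floor_add_fract y
      linarith
    rw [h3, Int.fract]
    ring

lemma B1_neg (y : ℝ) : B1 (-y) = - B1 y := by
  rw [B1_eq, B1_eq, Int.floor_neg, Int.ceil_neg]; push_cast; ring

lemma B1_add_int (y : ℝ) (n : ℤ) : B1 (y + n) = B1 y := by
  rw [B1_eq, B1_eq, Int.floor_add_intCast, Int.ceil_add_intCast]; push_cast; ring

lemma B1_congr (y z : ℝ) (n : ℤ) (h : y = z + n) : B1 y = B1 z := by
  rw [h, B1_add_int]

lemma B1_of_mem (y : ℝ) (h0 : 0 < y) (h1 : y < 1) : B1 y = y - 1 / 2 := by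
  have h2 : ⌊y⌋ = 0 := by rw [Int.floor_eq_iff]; constructor <;> push_cast <;> linarith
  have h3 : ⌈y⌉ = 1 := by rw [Int.ceil_eq_iff]; constructor <;> push_cast <;> linarith
  rw [B1_eq, h2, h3]; norm_num

lemma B1_zero : B1 0 = 0 := by rw [B1_eq]; simp

lemma B1_int (n : ℤ) : B1 n = 0 := by rw [B1_eq]; simp

lemma sum_shift (f : ℤ → ℝ) (c : ℕ) (hf : ∀ m, f (m + c) = f m) (s : ℕ) :
    ∑ m ∈ Finset.range c, f (m + s) = ∑ m ∈ Finset.range c, f m := by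
  induction s with
  | zero => simp
  | succ s ih =>
    rw [← ih]
    have h1 := Finset.sum_range_succ (fun m : ℕ => f (m + s)) c
    have h2 := Finset.sum_range_succ' (fun m : ℕ => f (m + s)) c
    have h3 : f ((c : ℤ) + s) = f (((0 : ℕ) : ℤ) + s) := by
      rw [add_comm, hf]; simp
    have h4 : ∑ m ∈ Finset.range c, f ((m : ℤ) + ((s + 1 : ℕ) : ℤ))
        = ∑ m ∈ Finset.range c, f (((m + 1 : ℕ) : ℤ) + s) := by
      apply Finset.sum_congr rfl
      intro m _
      congr 1
      push_cast; ring
    rw [h4]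
    linarith

lemma sum_odd (f : ℤ → ℝ) (c : ℕ) (hf : ∀ m, f (m + c) = f m) (ho : ∀ m, f (-m) = - f m) :
    ∑ m ∈ Finset.range c, f m = 0 := by
  have h1 := Finset.sum_range_reflect (fun m : ℕ => f m) c
  have h2 := sum_shift f c hf 1
  have h3 : ∑ j ∈ Finset.range c, f ((c - 1 - j : ℕ) : ℤ)
      = - ∑ m ∈ Finset.range c, f ((m : ℤ) + (1 : ℕ)) := by
    rw [← Finset.sum_neg_distrib]
    apply Finset.sum_congr rfl
    intro m hm
    rw [Finset.mem_range] at hm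
    rw [← ho, ← hf (-_)]
    congr 1
    omega
  linarith

/-- The Dedekind sum side, reduced to a short sum. -/
lemma core (C N : ℕ) (a K : ℤ) (hN : 0 < N) (hNC : N < C) (hK : (N : ℤ) * (a - 1) = K * C) :
    ∑ m ∈ Finset.range C, B1 ((m : ℝ) / C) * (B1 ((m : ℝ) * a / C) - B1 ((m : ℝ) * a / C - N / C))
    = ∑ m ∈ Finset.range N, B1 ((m : ℝ) * a / C - N / C) - 1 / 4 + (N : ℝ) / C / 2 := by
  have hC : (0 : ℝ) < C := by exact_mod_cast (by omega : 0 < C)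
  have hC' : (C : ℝ) ≠ 0 := hC.ne'
  have hKr : (N : ℝ) * (a - 1) = K * C := by exact_mod_cast hK
  have hNr : (0 : ℝ) < N := by exact_mod_cast hN
  have hNCr : (N : ℝ) < C := by exact_mod_cast hNC
  -- shift
  have e1 : ∑ m ∈ Finset.range C, B1 ((m : ℝ) / C) * B1 ((m : ℝ) * a / C - N / C)
      = ∑ m ∈ Finset.range C, B1 (((m : ℝ) + N) / C) * B1 ((m : ℝ) * a / C) := by
    have := sum_shift (fun m : ℤ => B1 ((m : ℝ) / C) * B1 ((m : ℝ) * a / C - N / C)) C ?_ N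
    · simp only [Int.cast_natCast] at this
      rw [← this]
      apply Finset.sum_congr rfl
      intro m _
      push_cast
      congr 1
      apply B1_congr _ _ K
      field_simp
      linear_combination hKr
    · intro m
      congr 1
      · apply B1_congr _ _ 1
        push_cast; field_simp
      · apply B1_congr _ _ a
        push_cast; field_simp; ring
  have e2 : ∑ m ∈ Finset.range C, B1 ((m : ℝ) * a / C) = 0 := by
    have := sum_odd (fun m : ℤ => B1 ((m : ℝ) * a / C)) C ?_ ?_
    · simpa using this
    · intro m
      apply B1_congr _ _ a
      push_cast; field_simp
    · intro m
      rw [← B1_neg]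
      congr 1
      push_cast; ring
  have e3 : ∑ m ∈ Finset.range C, B1 ((m : ℝ) / C) *
      (B1 ((m : ℝ) * a / C) - B1 ((m : ℝ) * a / C - N / C))
      = ∑ m ∈ Finset.range ((C - N) + N), B1 ((m : ℝ) * a / C) *
        (B1 ((m : ℝ) / C) - B1 (((m : ℝ) + N) / C) + N / C) := by
    rw [Nat.sub_add_cancel hNC.le]
    simp only [mul_sub, mul_add, Finset.sum_sub_distrib, Finset.sum_add_distrib]
    rw [e1, ← Finset.sum_mul, e2]
    simp only [mul_comm, zero_mul, mul_zero, add_zero]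
  rw [e3, Finset.sum_range_add]
  have e4 : ∑ m ∈ Finset.range (C - N), B1 ((m : ℝ) * a / C) *
        (B1 ((m : ℝ) / C) - B1 (((m : ℝ) + N) / C) + N / C) = 0 := by
    apply Finset.sum_eq_zero
    intro m hm
    rw [Finset.mem_range] at hm
    rcases Nat.eq_zero_or_pos m with rfl | hm0
    · simp [B1_zero]
    · have h1 : (0 : ℝ) < m := by exact_mod_cast hm0
      have h2 : (m : ℝ) + N < C := by exact_mod_cast (by omega : m + N < C)
      rw [B1_of_mem ((m : ℝ) / C) (by positivity) (by rw [div_lt_one hC]; linarith),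
        B1_of_mem (((m : ℝ) + N) / C) (by positivity) (by rw [div_lt_one hC]; linarith)]
      ring
  rw [e4, zero_add]
  obtain ⟨M, rfl⟩ : ∃ M, N = M + 1 := ⟨N - 1, by omega⟩
  rw [Finset.sum_range_succ', Finset.sum_range_succ' (n := M)]
  have hcast : ((C - (M + 1) : ℕ) : ℝ) = C - (M + 1 : ℕ) := by
    rw [Nat.cast_sub hNC.le]
  have e5 : ∀ m ∈ Finset.range M,
      B1 (((C - (M + 1) + (m + 1) : ℕ) : ℝ) * a / C) *
        (B1 (((C - (M + 1) + (m + 1) : ℕ) : ℝ) / C)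
          - B1 ((((C - (M + 1) + (m + 1) : ℕ) : ℝ) + (M + 1 : ℕ)) / C) + (M + 1 : ℕ) / C)
      = B1 (((m + 1 : ℕ) : ℝ) * a / C - (M + 1 : ℕ) / C) := by
    intro m hm
    rw [Finset.mem_range] at hm
    rw [Nat.cast_add (C - (M + 1)), hcast]
    set n : ℝ := ((m + 1 : ℕ) : ℝ) with hn
    set N : ℝ := ((M + 1 : ℕ) : ℝ) with hNdef
    have h1 : 0 < n := by rw [hn]; positivity
    have h2 : n < N := by rw [hn, hNdef]; exact_mod_cast (by omega : m + 1 < M + 1)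
    have h3 : B1 ((C - N + n + N) / C) = n / C - 1 / 2 := by
      rw [B1_congr _ (n / C) 1 (by push_cast; field_simp; ring)]
      exact B1_of_mem _ (by positivity) (by rw [div_lt_one hC]; linarith)
    rw [h3, B1_of_mem ((C - N + n) / C) (div_pos (by linarith) hC)
      (by rw [div_lt_one hC]; linarith)]
    rw [B1_congr ((C - N + n) * a / C) (n * a / C - N / C) (a - K)
      (by push_cast; field_simp; linear_combination -hKr)]
    field_simp
    ring
  rw [Finset.sum_congr rfl e5]
  have e6 : B1 (((0 : ℕ) : ℝ) * a / C - (M + 1 : ℕ) / C) = 1 / 2 - (M + 1 : ℕ) / C := by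
    rw [Nat.cast_zero, zero_mul, zero_div, zero_sub, B1_neg,
      B1_of_mem _ (by positivity) (by rw [div_lt_one hC]; exact hNCr)]
    ring
  have e7 : B1 (((C - (M + 1) + 0 : ℕ) : ℝ) * a / C) *
        (B1 (((C - (M + 1) + 0 : ℕ) : ℝ) / C)
          - B1 ((((C - (M + 1) + 0 : ℕ) : ℝ) + (M + 1 : ℕ)) / C) + (M + 1 : ℕ) / C)
      = (1 / 2 - (M + 1 : ℕ) / C) * (1 / 2) := by
    rw [add_zero, hcast]
    have h3 : B1 ((C - ((M + 1 : ℕ) : ℝ) + (M + 1 : ℕ)) / C) = 0 := by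
      rw [B1_congr _ 0 1 (by push_cast; field_simp; ring), B1_zero]
    rw [h3, B1_of_mem ((C - ((M + 1 : ℕ) : ℝ)) / C) (div_pos (by linarith) hC)
      (by rw [div_lt_one hC]; linarith), ← e6]
    rw [B1_congr ((C - ((M + 1 : ℕ) : ℝ)) * a / C) (((0 : ℕ) : ℝ) * a / C - (M + 1 : ℕ) / C) (a - K)
      (by push_cast; field_simp; push_cast at hKr; linear_combination -hKr)]
    field_simp
    ring
  rw [e7, e6]
  ring

lemma Tri_eq (a c : ℤ) (hc : 0 < c) (t : ℝ) (ht : 0 < t) :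
    t • Tri a c = {p : ℝ × ℝ | 0 ≤ p.2 ∧ c * p.1 ≤ (a - 1) * p.2 ∧ a * p.2 - t * c ≤ c * p.1} := by
  have hcr : (0 : ℝ) < c := by exact_mod_cast hc
  have hT : Tri a c = {p : ℝ × ℝ | 0 ≤ p.2 ∧ c * p.1 ≤ (a - 1) * p.2 ∧ a * p.2 - c ≤ c * p.1} := by
    apply Set.Subset.antisymm
    · apply convexHull_min
      · rintro p (rfl | rfl | rfl)
        · simp [hcr.le]
        · simp [hcr.le]; constructor <;> nlinarith
        · simp [hcr.le]
      · intro p hp q hq u v hu hv huv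
        obtain ⟨p1, p2, p3⟩ := hp
        obtain ⟨q1, q2, q3⟩ := hq
        refine ⟨?_, ?_, ?_⟩ <;> simp only [Prod.fst_add, Prod.snd_add, Prod.smul_fst, Prod.smul_snd, smul_eq_mul]
        · positivity
        · nlinarith [mul_le_mul_of_nonneg_left p2 hu, mul_le_mul_of_nonneg_left q2 hv]
        · have h : (c : ℝ) = u * c + v * c := by rw [← add_mul, huv, one_mul]
          nlinarith [mul_le_mul_of_nonneg_left p3 hu, mul_le_mul_of_nonneg_left q3 hv]
    · rintro ⟨x, y⟩ ⟨h1, h2, h3⟩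
      simp only at h1 h2 h3
      have hs := (convex_convexHull ℝ ({((0 : ℝ), (0 : ℝ)), (((a : ℝ) - 1), (c : ℝ)), ((-1 : ℝ), (0 : ℝ))} : Set (ℝ × ℝ))).sum_mem
        (t := Finset.univ)
        (w := ![1 - a * y / c + x, y / c, (a - 1) * y / c - x])
        (z := ![((0 : ℝ), (0 : ℝ)), (((a : ℝ) - 1), (c : ℝ)), ((-1 : ℝ), (0 : ℝ))]) ?_ ?_ ?_
      · unfold Tri
        convert hs using 1
        simp only [Fin.sum_univ_three, Matrix.cons_val_zero, Matrix.cons_val_one, Matrix.cons_val_two,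
          Matrix.cons_val]
        ext
        · simp; field_simp; ring
        · simp; field_simp
      · intro i _
        fin_cases i
        · simp only [Fin.zero_eta, Matrix.cons_val_zero]
          have : 1 - a * y / c + x = (c * x - (a * y - c)) / c := by field_simp; ring
          rw [this]; exact div_nonneg (by linarith) hcr.le
        · simp; positivity
        · simp
          rw [le_div_iff₀ hcr]; linarith
      · simp [Fin.sum_univ_three]; field_simp; ring
      · intro i _
        apply subset_convexHull
        fin_cases i <;> simp
  rw [hT]
  ext p
  rw [Set.mem_smul_set_iff_inv_smul_mem₀ ht.ne']
  simp only [Set.mem_setOf_eq, Prod.smul_fst, Prod.smul_snd, smul_eq_mul]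
  have e1 : 0 ≤ t⁻¹ * p.2 ↔ 0 ≤ p.2 := by
    constructor
    · intro h; have := mul_nonneg ht.le h; rwa [mul_inv_cancel_left₀ ht.ne'] at this
    · intro h; positivity
  have e2 : c * (t⁻¹ * p.1) ≤ (a - 1) * (t⁻¹ * p.2) ↔ c * p.1 ≤ (a - 1) * p.2 := by
    rw [← mul_le_mul_iff_right₀ ht]
    have h1 : t * (c * (t⁻¹ * p.1)) = c * p.1 := by field_simp
    have h2 : t * ((a - 1) * (t⁻¹ * p.2)) = (a - 1) * p.2 := by field_simp
    rw [h1, h2]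
  have e3 : a * (t⁻¹ * p.2) - c ≤ c * (t⁻¹ * p.1) ↔ a * p.2 - t * c ≤ c * p.1 := by
    rw [← mul_le_mul_iff_right₀ ht]
    have h1 : t * (c * (t⁻¹ * p.1)) = c * p.1 := by field_simp
    have h2 : t * (a * (t⁻¹ * p.2) - c) = a * p.2 - t * c := by field_simp
    rw [h1, h2]
  rw [e1, e2, e3]

lemma interior_half (u v r : ℝ) (h : u ≠ 0 ∨ v ≠ 0) :
    interior {p : ℝ × ℝ | r ≤ u * p.1 + v * p.2} = {p : ℝ × ℝ | r < u * p.1 + v * p.2} := by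
  let f : ℝ × ℝ →L[ℝ] ℝ := u • ContinuousLinearMap.fst ℝ ℝ ℝ + v • ContinuousLinearMap.snd ℝ ℝ ℝ
  have hf : ∀ p, f p = u * p.1 + v * p.2 := by intro p; simp [f]
  have hsurj : Function.Surjective f := by
    intro y
    rcases h with h | h
    · exact ⟨(y / u, 0), by rw [hf]; simp; field_simp⟩
    · exact ⟨(0, y / v), by rw [hf]; simp; field_simp⟩
  have ho : IsOpenMap f := f.isOpenMap hsurj
  have := ho.preimage_interior_eq_interior_preimage f.continuous (Set.Ici r)
  rw [interior_Ici] at this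
  have e1 : f ⁻¹' Set.Ici r = {p : ℝ × ℝ | r ≤ u * p.1 + v * p.2} := by ext p; simp [hf]
  have e2 : f ⁻¹' Set.Ioi r = {p : ℝ × ℝ | r < u * p.1 + v * p.2} := by ext p; simp [hf]
  rw [← e1, ← e2, this]

lemma interior_Tri (a c : ℤ) (hc : 0 < c) (t : ℝ) :
    interior {p : ℝ × ℝ | 0 ≤ p.2 ∧ c * p.1 ≤ (a - 1) * p.2 ∧ a * p.2 - t * c ≤ c * p.1}
    = {p : ℝ × ℝ | 0 < p.2 ∧ c * p.1 < (a - 1) * p.2 ∧ a * p.2 - t * c < c * p.1} := by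
  have hcr : (c : ℝ) ≠ 0 := by exact_mod_cast hc.ne'
  have e : {p : ℝ × ℝ | 0 ≤ p.2 ∧ c * p.1 ≤ (a - 1) * p.2 ∧ a * p.2 - t * c ≤ c * p.1}
    = {p : ℝ × ℝ | 0 ≤ 0 * p.1 + 1 * p.2} ∩ ({p : ℝ × ℝ | 0 ≤ (-c) * p.1 + (a - 1) * p.2} ∩
      {p : ℝ × ℝ | - t * c ≤ c * p.1 + (-a) * p.2}) := by
    ext p
    simp only [Set.mem_setOf_eq, Set.mem_inter_iff]
    refine and_congr ?_ (and_congr ?_ ?_)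
    · simp
    · constructor <;> intro h <;> linarith
    · constructor <;> intro h <;> linarith
  rw [e, interior_inter, interior_inter, interior_half _ _ _ (by simp), interior_half _ _ _ (by simp [hcr]),
    interior_half _ _ _ (by simp [hcr])]
  ext p
  simp only [Set.mem_setOf_eq, Set.mem_inter_iff]
  refine and_congr ?_ (and_congr ?_ ?_)
  · simp
  · constructor <;> intro h <;> linarith
  · constructor <;> intro h <;> linarith

lemma closed_Tri (a c : ℤ) (t : ℝ) :
    IsClosed {p : ℝ × ℝ | 0 ≤ p.2 ∧ c * p.1 ≤ (a - 1) * p.2 ∧ a * p.2 - t * c ≤ c * p.1} := by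
  have h1 : IsClosed {p : ℝ × ℝ | 0 ≤ p.2} := isClosed_le (by fun_prop) (by fun_prop)
  have h2 : IsClosed {p : ℝ × ℝ | c * p.1 ≤ (a - 1) * p.2} := isClosed_le (by fun_prop) (by fun_prop)
  have h3 : IsClosed {p : ℝ × ℝ | a * p.2 - t * c ≤ c * p.1} := isClosed_le (by fun_prop) (by fun_prop)
  exact h1.inter (h2.inter h3)

lemma volume_Tri (a c : ℤ) (hc : 0 < c) (t : ℝ) (ht : 0 < t) :
    (volume {p : ℝ × ℝ | 0 ≤ p.2 ∧ c * p.1 ≤ (a - 1) * p.2 ∧ a * p.2 - t * c ≤ c * p.1}).toReal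
      = t * (t * c) / 2 := by
  have hcr : (0 : ℝ) < c := by exact_mod_cast hc
  rw [Measure.volume_eq_prod, Measure.prod_apply_symm (closed_Tri a c t).measurableSet]
  have e : ∀ y : ℝ, volume ((fun x : ℝ => (x, y)) ⁻¹'
      {p : ℝ × ℝ | 0 ≤ p.2 ∧ c * p.1 ≤ (a - 1) * p.2 ∧ a * p.2 - t * c ≤ c * p.1})
      = (Set.Icc 0 (t * c)).indicator (fun y => ENNReal.ofReal (t - y / c)) y := by
    intro y
    by_cases hy : 0 ≤ y
    · have : ((fun x : ℝ => (x, y)) ⁻¹'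
        {p : ℝ × ℝ | 0 ≤ p.2 ∧ c * p.1 ≤ (a - 1) * p.2 ∧ a * p.2 - t * c ≤ c * p.1})
        = Set.Icc ((a * y - t * c) / c) ((a - 1) * y / c) := by
        ext x
        simp only [Set.mem_preimage, Set.mem_setOf_eq, Set.mem_Icc, hy, true_and]
        rw [le_div_iff₀ hcr, div_le_iff₀ hcr, mul_comm x, and_comm]
      rw [this, Real.volume_Icc]
      have h2 : (a - 1) * y / c - (a * y - t * c) / c = t - y / c := by field_simp; ring
      rw [h2]
      by_cases hy2 : y ≤ t * c
      · rw [Set.indicator_of_mem (Set.mem_Icc.2 ⟨hy, hy2⟩)]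
      · rw [Set.indicator_of_notMem (fun h => hy2 h.2), ENNReal.ofReal_eq_zero]
        rw [sub_nonpos, le_div_iff₀ hcr]; linarith
    · rw [Set.indicator_of_notMem (fun h => hy h.1)]
      convert measure_empty (μ := volume)
      ext x
      simp [hy]
  simp_rw [e]
  rw [lintegral_indicator measurableSet_Icc, ← ofReal_integral_eq_lintegral_ofReal]
  · have h0 : 0 ≤ t * c := by positivity
    rw [ENNReal.toReal_ofReal, integral_Icc_eq_integral_Ioc, ← intervalIntegral.integral_of_le h0]
    · rw [intervalIntegral.integral_sub, intervalIntegral.integral_const, intervalIntegral.integral_div, integral_id]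
      · simp; field_simp; ring
      · exact intervalIntegrable_const
      · exact (by fun_prop : Continuous fun x : ℝ => x / c).intervalIntegrable _ _
    · apply setIntegral_nonneg measurableSet_Icc
      intro y hy
      rw [sub_nonneg, div_le_iff₀ hcr]; exact hy.2
  · exact (by fun_prop : Continuous fun x : ℝ => t - x / c).integrableOn_Icc
  · rw [Filter.EventuallyLE, ae_restrict_iff' measurableSet_Icc]
    refine Filter.Eventually.of_forall ?_
    intro y hy
    simp only [Pi.zero_apply]
    rw [sub_nonneg, div_le_iff₀ hcr]; exact hy.2

lemma ncard_sigma (s : Finset ℤ) (f : ℤ → Finset ℤ) (A : Set (ℤ × ℤ))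
    (h : ∀ p, p ∈ A ↔ p.2 ∈ s ∧ p.1 ∈ f p.2) : A.Finite ∧ A.ncard = ∑ m ∈ s, (f m).card := by
  have : A = ((s.sigma f).image (fun q => (q.2, q.1)) : Finset (ℤ × ℤ)) := by
    ext ⟨i, j⟩
    rw [h]
    simp
  rw [this]
  refine ⟨Finset.finite_toSet _, ?_⟩
  rw [Set.ncard_coe_finset, Finset.card_image_of_injective, Finset.card_sigma]
  rintro ⟨i, j⟩ ⟨k, l⟩ h
  simp at h
  rw [h.1, h.2]

lemma count (C N : ℕ) (a K : ℤ) (hN : 0 < N) (hNC : N < C) (hK : (N : ℤ) * (a - 1) = K * C) :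
    (latticeCount (interior (((N : ℝ) / C) • Tri a C)) : ℝ)
      + (1 / 2) * (latticeCount (frontier (((N : ℝ) / C) • Tri a C)) : ℝ)
      - (volume (((N : ℝ) / C) • Tri a C)).toReal
    = 1 / 2 + ∑ m ∈ Finset.range N, B1 ((m : ℝ) * a / C - N / C) + (N : ℝ) / C / 2 := by
  have hC : (0 : ℝ) < C := by exact_mod_cast (by omega : 0 < C)
  have hC' : (C : ℝ) ≠ 0 := hC.ne'
  have hKr : (N : ℝ) * (a - 1) = K * C := by exact_mod_cast hK
  have hNr : (0 : ℝ) < N := by exact_mod_cast hN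
  have hNCr : (N : ℝ) < C := by exact_mod_cast hNC
  have ht : (0 : ℝ) < N / C := by positivity
  have hc : (0 : ℤ) < (C : ℤ) := by omega
  rw [Tri_eq a C hc _ ht, volume_Tri a C hc _ ht, (closed_Tri a C _).frontier_eq, interior_Tri a C hc]
  simp only [Int.cast_natCast, div_mul_cancel₀ _ hC']
  set α : ℤ → ℝ := fun m => m * a / C - N / C with hα
  set β : ℤ → ℝ := fun m => m * (a - 1) / C with hβ
  have hαβ : ∀ m : ℤ, β m - α m = (N - m) / C := by
    intro m; simp only [hα, hβ]; field_simp; ring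
  have hαβlt : ∀ m : ℤ, α m < β m ↔ m < N := by
    intro m
    rw [← sub_pos, hαβ, div_pos_iff_of_pos_right hC, sub_pos]
    exact_mod_cast Iff.rfl
  have hαβle : ∀ m : ℤ, α m ≤ β m ↔ m ≤ N := by
    intro m
    rw [← sub_nonneg, hαβ, le_div_iff₀ hC, zero_mul, sub_nonneg]
    exact_mod_cast Iff.rfl
  set P : Set (ℝ × ℝ) := {p : ℝ × ℝ | 0 ≤ p.2 ∧ C * p.1 ≤ (a - 1) * p.2 ∧ a * p.2 - N ≤ C * p.1} with hP
  set Q : Set (ℝ × ℝ) := {p : ℝ × ℝ | 0 < p.2 ∧ C * p.1 < (a - 1) * p.2 ∧ a * p.2 - N < C * p.1} with hQ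
  have hQP : Q ⊆ P := fun p hp => ⟨hp.1.le, hp.2.1.le, hp.2.2.le⟩
  have cP := ncard_sigma (Finset.Icc 0 (N : ℤ)) (fun m => Finset.Icc ⌈α m⌉ ⌊β m⌋)
    {p : ℤ × ℤ | ((p.1 : ℝ), (p.2 : ℝ)) ∈ P} (by
      rintro ⟨i, m⟩
      simp only [hP, Set.mem_setOf_eq, Finset.mem_Icc, Int.ceil_le, Int.le_floor]
      have h1 : α m ≤ i ↔ a * m - N ≤ C * (i : ℝ) := by
        simp only [hα]; rw [← sub_div, div_le_iff₀ hC, mul_comm (i : ℝ), mul_comm (m : ℝ)]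
      have h2 : i ≤ β m ↔ C * (i : ℝ) ≤ (a - 1) * m := by
        simp only [hβ]; rw [le_div_iff₀ hC, mul_comm (i : ℝ), mul_comm (m : ℝ)]
      rw [← h1, ← h2]
      have h3 : (0 : ℝ) ≤ m ↔ 0 ≤ m := by exact_mod_cast Iff.rfl
      rw [h3]
      constructor
      · rintro ⟨x, y, z⟩
        exact ⟨⟨x, (hαβle m).1 (z.trans y)⟩, z, y⟩
      · rintro ⟨⟨x, _⟩, z, y⟩
        exact ⟨x, y, z⟩)
  have cQ := ncard_sigma (Finset.Ioo 0 (N : ℤ)) (fun m => Finset.Ioo ⌊α m⌋ ⌈β m⌉)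
    {p : ℤ × ℤ | ((p.1 : ℝ), (p.2 : ℝ)) ∈ Q} (by
      rintro ⟨i, m⟩
      simp only [hQ, Set.mem_setOf_eq, Finset.mem_Ioo, Int.floor_lt, Int.lt_ceil]
      have h1 : α m < i ↔ a * m - N < C * (i : ℝ) := by
        simp only [hα]; rw [← sub_div, div_lt_iff₀ hC, mul_comm (i : ℝ), mul_comm (m : ℝ)]
      have h2 : i < β m ↔ C * (i : ℝ) < (a - 1) * m := by
        simp only [hβ]; rw [lt_div_iff₀ hC, mul_comm (i : ℝ), mul_comm (m : ℝ)]
      rw [← h1, ← h2]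
      have h3 : (0 : ℝ) < m ↔ 0 < m := by exact_mod_cast Iff.rfl
      rw [h3]
      constructor
      · rintro ⟨x, y, z⟩
        exact ⟨⟨x, (hαβlt m).1 (z.trans y)⟩, z, y⟩
      · rintro ⟨⟨x, _⟩, z, y⟩
        exact ⟨x, y, z⟩)
  have cF : (latticeCount (P \ Q) : ℝ) = latticeCount P - latticeCount Q := by
    have h1 : {p : ℤ × ℤ | ((p.1 : ℝ), (p.2 : ℝ)) ∈ Q} ⊆ {p : ℤ × ℤ | ((p.1 : ℝ), (p.2 : ℝ)) ∈ P} :=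
      fun p hp => hQP hp
    have h2 := Set.ncard_diff_add_ncard_of_subset h1 cP.1
    have h3 : latticeCount (P \ Q) + latticeCount Q = latticeCount P := h2
    rw [← h3]; push_cast; ring
  have dP : (latticeCount P : ℝ) = ∑ m ∈ Finset.Icc 0 (N : ℤ), ((⌊β m⌋ : ℝ) + 1 - ⌈α m⌉) := by
    have : latticeCount P = _ := cP.2
    rw [this]
    push_cast
    apply Finset.sum_congr rfl
    intro m hm
    rw [Finset.mem_Icc] at hm
    have h1 := (hαβle m).2 hm.2
    have h2 := Int.ceil_lt_add_one (α m)
    have h3 := Int.lt_floor_add_one (β m)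
    have h4 : ⌈α m⌉ < ⌊β m⌋ + 2 := by
      have : (⌈α m⌉ : ℝ) < ⌊β m⌋ + 2 := by linarith
      exact_mod_cast this
    rw [Int.card_Icc]
    have h5 : (((⌊β m⌋ + 1 - ⌈α m⌉).toNat : ℤ) : ℝ) = ((⌊β m⌋ + 1 - ⌈α m⌉ : ℤ) : ℝ) := by
      rw [Int.toNat_of_nonneg (by omega)]
    push_cast at h5 ⊢
    exact h5
  have dQ : (latticeCount Q : ℝ) = ∑ m ∈ Finset.Ioo 0 (N : ℤ), ((⌈β m⌉ : ℝ) - ⌊α m⌋ - 1) := by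
    have : latticeCount Q = _ := cQ.2
    rw [this]
    push_cast
    apply Finset.sum_congr rfl
    intro m hm
    rw [Finset.mem_Ioo] at hm
    have h1 := (hαβlt m).2 hm.2
    have h2 := Int.floor_le (α m)
    have h3 := Int.le_ceil (β m)
    have h4 : ⌊α m⌋ < ⌈β m⌉ := by
      have : (⌊α m⌋ : ℝ) < ⌈β m⌉ := by linarith
      exact_mod_cast this
    rw [Int.card_Ioo]
    have h5 : (((⌈β m⌉ - ⌊α m⌋ - 1).toNat : ℤ) : ℝ) = ((⌈β m⌉ - ⌊α m⌋ - 1 : ℤ) : ℝ) := by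
      rw [Int.toNat_of_nonneg (by omega)]
    push_cast at h5 ⊢
    exact h5
  -- split the closed sum
  have hsplit : Finset.Icc 0 (N : ℤ) = insert 0 (insert (N : ℤ) (Finset.Ioo 0 (N : ℤ))) := by
    ext m; simp only [Finset.mem_Icc, Finset.mem_insert, Finset.mem_Ioo]; omega
  have hrange : ∀ g : ℤ → ℝ, ∑ m ∈ Finset.range N, g m = g 0 + ∑ m ∈ Finset.Ioo 0 (N : ℤ), g m := by
    intro g
    have h1 : (Finset.range N).image (fun n : ℕ => (n : ℤ)) = insert 0 (Finset.Ioo 0 (N : ℤ)) := by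
      ext m
      simp only [Finset.mem_image, Finset.mem_range, Finset.mem_insert, Finset.mem_Ioo]
      constructor
      · rintro ⟨n, h, rfl⟩; omega
      · intro h; exact ⟨m.toNat, by omega, by omega⟩
    rw [← Finset.sum_insert (by simp), ← h1, Finset.sum_image (by intro x _ y _ h; simpa using h)]
  have hβ0 : β 0 = 0 := by simp [hβ]
  have hα0 : α 0 = -(N / C) := by simp [hα]
  have hlt1 : (N : ℝ) / C < 1 := by rw [div_lt_one hC]; exact hNCr
  have hcα0 : ⌈α 0⌉ = 0 := by
    rw [hα0, Int.ceil_eq_iff]; constructor <;> push_cast <;> linarith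
  have hβN : β N = K := by
    simp only [hβ]; push_cast; rw [hKr]; field_simp
  have hαN : α N = K := by
    have := hαβ N
    rw [hβN] at this; push_cast at this; rw [sub_self, zero_div] at this; linarith
  rw [hsplit, Finset.sum_insert (by simp; omega), Finset.sum_insert (by simp), hβ0, hcα0, hβN, hαN] at dP
  simp only [Int.floor_zero, Int.ceil_intCast, Int.floor_intCast, Int.cast_zero] at dP
  have hB1α0 : B1 (α 0) = 1 / 2 - N / C := by
    rw [hα0, B1_neg, B1_of_mem _ ht hlt1]; ring
  have s1 : ∑ m ∈ Finset.range N, B1 ((m : ℝ) * a / C - N / C)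
      = B1 (α 0) + ∑ m ∈ Finset.Ioo 0 (N : ℤ), B1 (α m) := by
    rw [← hrange (fun m => B1 (α m))]
    simp [hα]
  have s2 : ∑ m ∈ Finset.Ioo 0 (N : ℤ), B1 (β m) = 0 := by
    have h1 := hrange (fun m => B1 (β m))
    have h2 := sum_odd (fun m => B1 (β m)) N ?_ ?_
    · rw [h2] at h1
      simp only [hβ0, B1_zero] at h1
      linarith
    · intro m
      apply B1_congr _ _ K
      simp only [hβ]; push_cast; field_simp; linear_combination hKr
    · intro m
      rw [← B1_neg]; congr 1
      simp only [hβ]; push_cast; ring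
  have s3 : ∑ m ∈ Finset.Ioo 0 (N : ℤ), (β m - α m) = N / C * (N - 1) / 2 := by
    have h1 := hrange (fun m => β m - α m)
    have h2 : ∀ M : ℕ, ∑ m ∈ Finset.range M, (β m - α m) = (M * N - M * (M - 1) / 2) / C := by
      intro M
      induction M with
      | zero => simp
      | succ M ih =>
        rw [Finset.sum_range_succ, ih, hαβ]; push_cast; field_simp; ring
    rw [h2, hβ0, hα0] at h1
    have : ∑ m ∈ Finset.Ioo 0 (N : ℤ), (β m - α m) = (N * N - N * (N - 1) / 2) / C - N / C := by linarith
    rw [this]; field_simp; ring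
  have s4 : ∑ m ∈ Finset.Ioo 0 (N : ℤ), ((⌈β m⌉ : ℝ) - ⌊α m⌋ - 1)
      + ∑ m ∈ Finset.Ioo 0 (N : ℤ), ((⌊β m⌋ : ℝ) + 1 - ⌈α m⌉)
      = 2 * (∑ m ∈ Finset.Ioo 0 (N : ℤ), (β m - α m) - ∑ m ∈ Finset.Ioo 0 (N : ℤ), B1 (β m)
        + ∑ m ∈ Finset.Ioo 0 (N : ℤ), B1 (α m)) := by
    rw [← Finset.sum_add_distrib, ← Finset.sum_sub_distrib, ← Finset.sum_add_distrib, Finset.mul_sum]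
    apply Finset.sum_congr rfl
    intro m _
    rw [B1_eq, B1_eq]; ring
  rw [s2, s3] at s4
  rw [cF, s1, hB1α0]
  have : (latticeCount Q : ℝ) + 1 / 2 * (latticeCount P - latticeCount Q)
    = 1 / 2 * (latticeCount P + latticeCount Q) := by ring
  rw [this]
  have h6 : (latticeCount P : ℝ) + latticeCount Q = 2 + 2 * (N / C * (N - 1) / 2 - 0
        + ∑ m ∈ Finset.Ioo 0 (N : ℤ), B1 (α m)) := by
    rw [← s4, dP, dQ]; ring
  rw [h6]
  ring

/-- **Theorem (Statement 0).** Hayes-type formula for the cocycle `𝔷₀` at `s = 0`. -/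
theorem statement0 (a b c d : ℤ) (hdet : a * d - b * c = 1) (hc : 0 < c)
    (hl : 1 < Int.gcd c (a - 1)) (x₁ : ℚ)
    (hx : ∃ n : ℤ, x₁ = (n : ℚ) / (Int.gcd c (a - 1) : ℚ)) (hx' : x₁.den ≠ 1)
    (ω₁ ω₂ : ℝ) (hω : LinearIndependent ℚ ![ω₁, ω₂]) :
    Z0 a c x₁ 0 ω₁ ω₂
      - Z0 a c ((Int.gcd c (a - 1) : ℚ) * x₁) 0
          (ω₁ / (Int.gcd c (a - 1) : ℝ)) (ω₂ / (Int.gcd c (a - 1) : ℝ))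
    = (latticeCount (interior (Int.fract (x₁ : ℝ) • Tri a c)) : ℝ)
      + (1 / 2) * (latticeCount (frontier (Int.fract (x₁ : ℝ) • Tri a c)) : ℝ)
      - (volume (Int.fract (x₁ : ℝ) • Tri a c)).toReal
      + (Real.sign ((a : ℝ) + c * (ω₂ / ω₁)) - 3) / 4 := by
  obtain ⟨n, hn⟩ := hx
  set ℓ := Int.gcd c (a - 1) with hℓ
  have hℓ0 : (0 : ℝ) < ℓ := by exact_mod_cast (by omega : 0 < ℓ)
  have hℓq : (ℓ : ℚ) ≠ 0 := by exact_mod_cast (by omega : ℓ ≠ 0)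
  have hgcd : Int.gcd a c = 1 := by
    rw [← Int.isCoprime_iff_gcd_eq_one]
    exact ⟨d, -b, by linarith⟩
  obtain ⟨c', hc'⟩ : (ℓ : ℤ) ∣ c := Int.gcd_dvd_left ..
  obtain ⟨a', ha'⟩ : (ℓ : ℤ) ∣ a - 1 := Int.gcd_dvd_right ..
  have hc'r : (c : ℝ) = ℓ * c' := by exact_mod_cast hc'
  have hc'0 : 0 < c' := by
    have h : (0 : ℤ) < ℓ := by omega
    rw [hc'] at hc
    exact pos_of_mul_pos_right hc h.le
  have hxr : (x₁ : ℝ) = n / ℓ := by rw [hn]; push_cast; rfl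
  have hlx : (ℓ : ℚ) * x₁ = n := by rw [hn]; field_simp
  rw [hlx]
  -- remainder
  have hℓz : (0 : ℤ) < ℓ := by omega
  have hdm := Int.emod_add_mul_ediv n ℓ
  have hk0 := Int.emod_nonneg n hℓz.ne'
  have hk1 := Int.emod_lt_of_pos n hℓz
  set k := n % ℓ with hk
  set q := n / (ℓ : ℤ) with hq
  have hkne : k ≠ 0 := by
    intro h
    apply hx'
    rw [h, zero_add] at hdm
    have : x₁ = (q : ℚ) := by
      rw [hn, ← hdm]; push_cast; field_simp
    rw [this]; simp
  have hfr : Int.fract (x₁ : ℝ) = k / ℓ := by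
    rw [Int.fract_eq_iff]
    refine ⟨by positivity, ?_, q, ?_⟩
    · rw [div_lt_one hℓ0]; exact_mod_cast hk1
    · rw [hxr]
      have : (n : ℝ) = k + ℓ * q := by exact_mod_cast hdm.symm
      rw [this]; field_simp; ring
  lift c to ℕ using hc.le with C
  obtain ⟨N, hN⟩ : ∃ N : ℕ, (N : ℤ) = k * c' := ⟨(k * c').toNat, by
    rw [Int.toNat_of_nonneg (by positivity)]⟩
  have hN0 : 0 < N := by
    have h : 0 < k * c' := mul_pos (by omega) hc'0
    omega
  have hNC : N < C := by
    have h : k * c' < ℓ * c' := mul_lt_mul_of_pos_right hk1 hc'0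
    omega
  have hK : (N : ℤ) * (a - 1) = (k * a') * C := by
    rw [hN, ha', hc']; ring
  have hCr : (0 : ℝ) < C := by exact_mod_cast hc
  have hc'rr : (0 : ℝ) < c' := by exact_mod_cast hc'0
  rw [Int.cast_natCast] at hc'r
  have hfr2 : Int.fract (x₁ : ℝ) = N / C := by
    have h : (N : ℝ) = k * c' := by exact_mod_cast hN
    rw [hfr, h, hc'r]; field_simp
  have hx1 : (x₁ : ℝ) = N / C + (⌊(x₁ : ℝ)⌋ : ℤ) := by
    rw [← hfr2]; exact (Int.fract_add_floor _).symm
  have key := core C N a _ hN0 hNC hK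
  have cnt := count C N a _ hN0 hNC hK
  have hB2 : ∀ z : ℤ, B2 (z : ℝ) = 1 / 6 := by intro z; simp [B2]
  have hcx : ((C : ℤ) : ℝ) * (x₁ : ℝ) = ((c' * n : ℤ) : ℝ) := by
    rw [hxr, Int.cast_natCast, hc'r]; push_cast; field_simp
  have hcx2 : ((C : ℤ) : ℝ) * (((n : ℤ) : ℚ) : ℝ) = ((C * n : ℤ) : ℝ) := by push_cast; ring
  have hind1 : indZ x₁ = 0 := by simp [indZ, hx']
  have hind2 : indZ (n : ℚ) = 1 := by simp [indZ]
  have hind3 : indZ 0 = 1 := by simp [indZ]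
  have hsgn : Real.sign (C : ℝ) = 1 := Real.sign_of_pos hCr
  have hsgn2 : ∀ y : ℝ, Real.sign ((C : ℝ) * y) = Real.sign y := by
    intro y
    rcases lt_trichotomy y 0 with h | h | h
    · rw [Real.sign_of_neg h, Real.sign_of_neg (mul_neg_of_pos_of_neg hCr h)]
    · rw [h, mul_zero]
    · rw [Real.sign_of_pos h, Real.sign_of_pos (mul_pos hCr h)]
  have hDR : DR (-a) C (x₁ : ℝ) 0 - DR (-a) C (n : ℝ) 0
      = ∑ m ∈ Finset.range C, B1 ((m : ℝ) / C) * (B1 ((m : ℝ) * a / C) - B1 ((m : ℝ) * a / C - N / C)) := by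
    unfold DR
    rw [← Finset.sum_sub_distrib, Int.natAbs_natCast]
    apply Finset.sum_congr rfl
    intro m _
    have h1 : B1 ((x₁ : ℝ) + (0 + m) * (-a : ℤ) / (C : ℤ)) = - B1 ((m : ℝ) * a / C - N / C) := by
      rw [← B1_neg]
      apply B1_congr _ _ ⌊(x₁ : ℝ)⌋
      nth_rewrite 1 [hx1]
      push_cast; ring
    have h2 : B1 ((n : ℝ) + (0 + m) * (-a : ℤ) / (C : ℤ)) = - B1 ((m : ℝ) * a / C) := by
      rw [← B1_neg]
      apply B1_congr _ _ n
      push_cast; ring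
    rw [h1, h2]
    push_cast
    rw [zero_add]; ring
  rw [hfr2, cnt]
  unfold Z0
  rw [div_div_div_cancel_right₀ hℓ0.ne', hgcd, hind1, hind2, hind3]
  simp only [Nat.cast_one, div_one, Rat.cast_zero, mul_zero, sub_zero]
  rw [hcx, hcx2, hB2, hB2]
  simp only [Int.cast_natCast, hsgn, hsgn2, Rat.cast_intCast]
  linarith
end

section
/- Let γ=((a,b),(c,d)) and γ'=((a',b'),(c',d')) be in SL₂(ℤ) with c>0, c'>0, and ca'+dc'>0, and set ℓ := gcd(ℓ_γ, ℓ_{γ'}). For σ ∈ {γ, γ', γγ'} with lower-left entry c_σ, define G₀(ℓ⁻¹T_σ, m) := #(ℤ² ∩ (m/ℓ)·T_σ) − (c_σ/(2ℓ²))·m² − ((ℓ_σ+2)/(2ℓ))·m for m ∈ ℤ_{≥0}. Then for all m ∈ ℤ_{≥0}: G₀(ℓ⁻¹T_{γγ'}, m) = G₀(ℓ⁻¹T_γ, m) + G₀(ℓ⁻¹T_{γ'}, m) + {m/ℓ} − 1. -/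
open scoped Pointwise Classical
open MeasureTheory

lemma rows_count (lo hi : ℤ) (L U : ℤ → ℤ) (S : Set (ℤ × ℤ))
    (hS : ∀ x y : ℤ, (x, y) ∈ S ↔ (lo ≤ y ∧ y ≤ hi) ∧ (L y ≤ x ∧ x ≤ U y)) :
    S.Finite ∧ S.ncard = ∑ y ∈ Finset.Icc lo hi, (U y + 1 - L y).toNat := by
  have e : S = ((((Finset.Icc lo hi).sigma (fun y => Finset.Icc (L y) (U y))).map
      ⟨fun s : (_ : ℤ) × ℤ => ((s.2, s.1) : ℤ × ℤ), by
        rintro ⟨a, b⟩ ⟨c, d⟩ h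
        simp only [Prod.mk.injEq] at h
        obtain ⟨rfl, rfl⟩ := h
        rfl⟩ : Finset (ℤ × ℤ)) : Set (ℤ × ℤ)) := by
    ext ⟨x, y⟩
    rw [hS]
    simp only [Finset.coe_map, Set.mem_image, Finset.mem_coe,
      Finset.mem_sigma, Finset.mem_Icc]
    constructor
    · intro h
      exact ⟨⟨y, x⟩, h, rfl⟩
    · rintro ⟨⟨u, v⟩, h, h2⟩
      cases h2
      exact h
  constructor
  · rw [e]; exact Finset.finite_toSet _
  · rw [e, Set.ncard_coe_finset, Finset.card_map, Finset.card_sigma]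
    simp

lemma le_div (x a c : ℤ) (hc : 0 < c) : c * x ≤ a ↔ x ≤ a / c := by
  rw [Int.le_ediv_iff_mul_le hc, mul_comm]

lemma dvd_count (p q : ℤ) (m : ℕ) (hq : 0 < q) :
    ((Finset.Icc 1 (m * q)).filter (fun z => q ∣ p * z)).card = m * Int.gcd p q := by
  obtain ⟨g, hg⟩ : ∃ g : ℕ, g = Int.gcd p q := ⟨_, rfl⟩
  have hg0 : 0 < Int.gcd p q := Int.gcd_pos_of_ne_zero_right _ hq.ne'
  obtain ⟨p0, q0, hco, hp, hq'⟩ := Int.exists_gcd_one hg0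
  rw [← hg] at hp hq' hg0 ⊢
  have hgz : (0 : ℤ) < g := by exact_mod_cast hg0
  have hq0 : 0 < q0 := by
    rw [hq'] at hq
    exact pos_of_mul_pos_left hq hgz.le
  have : (Finset.Icc 1 (m * q)).filter (fun z => q ∣ p * z)
      = (Finset.Icc (1 : ℤ) (m * g : ℕ)).image (fun k => q0 * k) := by
    ext z
    simp only [Finset.mem_filter, Finset.mem_Icc, Finset.mem_image]
    constructor
    · rintro ⟨⟨h1, h2⟩, h3⟩
      have : q0 ∣ p0 * z := by
        rw [hp, hq'] at h3
        have : g * q0 ∣ (g : ℤ) * (p0 * z) := by convert h3 using 1 <;> ring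
        exact (mul_dvd_mul_iff_left hgz.ne').1 this
      obtain ⟨k, rfl⟩ := (Int.isCoprime_iff_gcd_eq_one.2 hco).symm.dvd_of_dvd_mul_left this
      refine ⟨k, ⟨?_, ?_⟩, rfl⟩
      · have : 0 < k := pos_of_mul_pos_right (by linarith : 0 < q0 * k) hq0.le
        linarith
      · rw [hq'] at h2
        push_cast
        have : q0 * k ≤ q0 * (m * g) := by linarith
        exact le_of_mul_le_mul_left this hq0
    · rintro ⟨k, ⟨h1, h2⟩, rfl⟩
      push_cast at h2
      refine ⟨⟨by nlinarith, ?_⟩, ?_⟩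
      · rw [hq']; nlinarith
      · rw [hq', hp]; exact ⟨p0 * k, by ring⟩
  rw [this, Finset.card_image_of_injective _ (mul_right_injective₀ hq0.ne')]
  simp only [Int.card_Icc]
  omega

lemma floor_pair (q x : ℤ) (hq : 0 < q) : x / q + (-x) / q = -1 + if q ∣ x then 1 else 0 := by
  split_ifs with h
  · obtain ⟨k, rfl⟩ := h
    rw [← mul_neg, Int.mul_ediv_cancel_left _ hq.ne', Int.mul_ediv_cancel_left _ hq.ne']
    ring
  · rw [Int.neg_ediv, if_neg h, Int.sign_eq_one_of_pos hq]
    ring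

lemma floor_sum (p q : ℤ) (m : ℕ) (hq : 0 < q) :
    2 * ∑ z ∈ Finset.Icc 1 (m * q), (p * z) / q
      = (m : ℤ) ^ 2 * p * q + m * p - m * q + m * (Int.gcd p q : ℕ) := by
  have hmq : 0 ≤ m * q := by positivity
  -- sum over Icc 1 N of f (N - z)
  have e1 : ∑ z ∈ Finset.Icc 1 (m * q), (p * z) / q
      = ∑ z ∈ Finset.Icc 0 (m * q), (p * z) / q := by
    apply Finset.sum_subset
    · intro z; simp only [Finset.mem_Icc]; omega
    · intro z hz hz'
      simp only [Finset.mem_Icc] at hz hz'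
      have : z = 0 := by omega
      subst this; simp
  have e2 : ∑ z ∈ Finset.Icc 0 (m * q), (p * z) / q
      = ∑ z ∈ Finset.Icc 0 (m * q), (m * p + (-(p * z)) / q) := by
    apply Finset.sum_nbij' (fun z => m * q - z) (fun z => m * q - z)
    · intro z; simp only [Finset.mem_Icc]; omega
    · intro z; simp only [Finset.mem_Icc]; omega
    · intro z _; ring
    · intro z _; ring
    · intro z _
      have : -(p * (m * q - z)) = p * z + -(m * p) * q := by ring
      rw [this, Int.add_mul_ediv_right _ _ hq.ne']
      ring
  have e3 : ∑ z ∈ Finset.Icc 0 (m * q), (m * p + (-(p * z)) / q)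
      = m * p + ∑ z ∈ Finset.Icc 1 (m * q), (m * p + (-(p * z)) / q) := by
    have : Finset.Icc 0 (m * q) = insert 0 (Finset.Icc 1 (m * q)) := by
      ext z; simp only [Finset.mem_insert, Finset.mem_Icc]; omega
    rw [this, Finset.sum_insert (by simp)]
    simp
  have e4 : ∑ z ∈ Finset.Icc 1 (m * q), (m * p + (-(p * z)) / q)
      + ∑ z ∈ Finset.Icc 1 (m * q), (p * z) / q
      = ∑ z ∈ Finset.Icc 1 (m * q), ((m * p - 1) + if q ∣ p * z then 1 else 0) := by
    rw [← Finset.sum_add_distrib]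
    apply Finset.sum_congr rfl
    intro z _
    have := floor_pair q (p * z) hq
    linarith
  have e5 : ∑ z ∈ Finset.Icc 1 (m * q), ((m * p - 1) + if q ∣ p * z then (1 : ℤ) else 0)
      = m * q * (m * p - 1) + m * (Int.gcd p q : ℕ) := by
    rw [Finset.sum_add_distrib, Finset.sum_boole, dvd_count p q m hq]
    simp only [Finset.sum_const, Int.card_Icc, nsmul_eq_mul]
    push_cast
    rw [show m * q + 1 - 1 = m * q by ring, Int.toNat_of_nonneg hmq]
  linear_combination e1 + e2 + e3 + e4 + e5

lemma N1 (g q r : ℤ) (m : ℕ) (hg : 0 < g) (hq : 0 < q) (S : Set (ℤ × ℤ))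
    (hS : ∀ x z : ℤ, (x, z) ∈ S ↔ 0 < z ∧ r * z ≤ q * x ∧ q * x + (g - r) * z ≤ m * q * g) :
    S.Finite ∧ 2 * (S.ncard : ℤ) = (m : ℤ) ^ 2 * (g * q) - m * g
      + m * (Int.gcd r q : ℕ) + m * (Int.gcd (r - g) q : ℕ) := by
  have hq' := hq.ne'
  obtain ⟨h1, h2⟩ := rows_count 1 (m * q) (fun z => -((-r * z) / q))
    (fun z => m * g + ((r - g) * z) / q) S (by
      intro x z
      rw [hS]
      have i1 : r * z ≤ q * x ↔ -((-r * z) / q) ≤ x := by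
        rw [neg_le, ← le_div _ _ _ hq]; constructor <;> intro h <;> linarith
      have i2 : q * x + (g - r) * z ≤ m * q * g ↔ x ≤ m * g + ((r - g) * z) / q := by
        rw [← sub_le_iff_le_add', ← le_div _ _ _ hq]; constructor <;> intro h <;> linarith
      rw [← i1, ← i2]
      constructor
      · rintro ⟨a, b, c⟩
        refine ⟨⟨by linarith, ?_⟩, b, c⟩
        have : g * z ≤ g * (m * q) := by linarith
        exact le_of_mul_le_mul_left this hg
      · rintro ⟨⟨a, a'⟩, b, c⟩
        exact ⟨by linarith, b, c⟩)
  refine ⟨h1, ?_⟩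
  rw [h2]
  push_cast
  have : ∀ z ∈ Finset.Icc 1 (m * q), (((m * g + ((r - g) * z) / q + 1 - -((-r * z) / q)).toNat : ℕ) : ℤ)
      = (m * g + 1) + ((r - g) * z) / q + (-r * z) / q := by
    intro z hz
    simp only [Finset.mem_Icc] at hz
    rw [Int.toNat_of_nonneg]
    · ring
    · have a1 := Int.lt_ediv_add_one_mul_self ((r - g) * z) hq
      have a2 := Int.lt_ediv_add_one_mul_self (-r * z) hq
      have : g * z ≤ g * (m * q) := mul_le_mul_of_nonneg_left hz.2 hg.le
      have : 0 < q * (m * g + ((r - g) * z) / q + 1 - -((-r * z) / q) + 1) := by nlinarith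
      have := pos_of_mul_pos_right this hq.le
      linarith
  rw [Finset.sum_congr rfl this, Finset.sum_add_distrib, Finset.sum_add_distrib, Finset.sum_const]
  have f1 := floor_sum (r - g) q m hq
  have f2 := floor_sum (-r) q m hq
  rw [Int.neg_gcd] at f2
  simp only [Int.card_Icc, nsmul_eq_mul]
  rw [show m * q + 1 - 1 = m * q by ring, Int.toNat_of_nonneg (by positivity)]
  linear_combination f1 + f2

lemma N2 (g q r : ℤ) (m : ℕ) (hg : 0 < g) (hq : 0 < q) (hm : 0 < m) (S : Set (ℤ × ℤ))
    (hS : ∀ x z : ℤ, (x, z) ∈ S ↔ 0 ≤ z ∧ r * z < q * x ∧ q * x + (g - r) * z < m * q * g) :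
    S.Finite ∧ 2 * (S.ncard : ℤ) = (m : ℤ) ^ 2 * (g * q) + m * g
      - m * (Int.gcd r q : ℕ) - m * (Int.gcd (g - r) q : ℕ) := by
  have hq' := hq.ne'
  have hmz : (0 : ℤ) < m := by exact_mod_cast hm
  have hmq : 0 < m * q := by positivity
  obtain ⟨h1, h2⟩ := rows_count 0 (m * q - 1) (fun z => r * z / q + 1)
    (fun z => m * g - ((g - r) * z) / q - 1) S (by
      intro x z
      rw [hS]
      have i1 : r * z < q * x ↔ r * z / q + 1 ≤ x := by
        rw [Int.add_one_le_iff, Int.ediv_lt_iff_lt_mul hq, mul_comm x]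
      have i2 : q * x + (g - r) * z < m * q * g ↔ x ≤ m * g - ((g - r) * z) / q - 1 := by
        rw [Int.le_sub_one_iff, lt_sub_comm, Int.ediv_lt_iff_lt_mul hq]
        constructor <;> intro h <;> linarith
      rw [← i1, ← i2]
      constructor
      · rintro ⟨a, b, c⟩
        refine ⟨⟨by linarith, ?_⟩, b, c⟩
        have : g * z < g * (m * q) := by linarith
        have := lt_of_mul_lt_mul_left this hg.le
        omega
      · rintro ⟨⟨a, a'⟩, b, c⟩
        exact ⟨by linarith, b, c⟩)
  refine ⟨h1, ?_⟩
  rw [h2]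
  push_cast
  have : ∀ z ∈ Finset.Icc 0 (m * q - 1), (((m * g - ((g - r) * z) / q - 1 + 1 - (r * z / q + 1)).toNat : ℕ) : ℤ)
      = (m * g - 1) - (((g - r) * z) / q + (r * z) / q) := by
    intro z hz
    simp only [Finset.mem_Icc] at hz
    rw [Int.toNat_of_nonneg]
    · ring
    · have a1 := Int.ediv_mul_le ((g - r) * z) hq'
      have a2 := Int.ediv_mul_le (r * z) hq'
      have : g * z < g * (m * q) := mul_lt_mul_of_pos_left (by linarith) hg
      have : 0 < q * (m * g - ((g - r) * z) / q - 1 + 1 - (r * z / q + 1) + 1) := by nlinarith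
      have := pos_of_mul_pos_right this hq.le
      linarith
  rw [Finset.sum_congr rfl this]
  have e : ∑ z ∈ Finset.Icc 0 (m * q - 1), ((m * g - 1) - (((g - r) * z) / q + (r * z) / q))
      = ∑ z ∈ Finset.Icc 1 (m * q), ((m * g - 1) - (((g - r) * z) / q + (r * z) / q)) + m * g := by
    have a1 : Finset.Icc 0 (m * q) = insert 0 (Finset.Icc 1 (m * q)) := by
      ext z; simp only [Finset.mem_insert, Finset.mem_Icc]; omega
    have a2 : Finset.Icc 0 (m * q) = insert (m * q) (Finset.Icc 0 (m * q - 1)) := by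
      ext z; simp only [Finset.mem_insert, Finset.mem_Icc]; omega
    have a3 := congrArg (fun s => ∑ z ∈ s, ((m * g - 1) - (((g - r) * z) / q + (r * z) / q))) (a1.symm.trans a2)
    rw [Finset.sum_insert (by simp), Finset.sum_insert (by simp)] at a3
    have b1 : (g - r) * (m * q) / q = (g - r) * m := by
      rw [← mul_assoc, Int.mul_ediv_cancel _ hq']
    have b2 : r * (m * q) / q = r * m := by
      rw [← mul_assoc, Int.mul_ediv_cancel _ hq']
    rw [b1, b2] at a3
    simp only [mul_zero, Int.zero_ediv] at a3
    linarith
  rw [e, Finset.sum_sub_distrib, Finset.sum_add_distrib, Finset.sum_const]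
  have f1 := floor_sum (g - r) q m hq
  have f2 := floor_sum r q m hq
  simp only [Int.card_Icc, nsmul_eq_mul]
  rw [show m * q + 1 - 1 = m * q by ring, Int.toNat_of_nonneg (by positivity)]
  linear_combination -f1 - f2

lemma gcd_inv (p q r s x y : ℤ) (hd : p * s - q * r = 1) :
    Int.gcd (p * x + q * y) (r * x + s * y) = Int.gcd x y := by
  apply Nat.dvd_antisymm
  · apply Int.natCast_dvd_natCast.1
    have h1 : ((Int.gcd (p * x + q * y) (r * x + s * y) : ℕ) : ℤ) ∣ _ := Int.gcd_dvd_left _ _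
    have h2 : ((Int.gcd (p * x + q * y) (r * x + s * y) : ℕ) : ℤ) ∣ _ := Int.gcd_dvd_right _ _
    apply Int.dvd_coe_gcd
    · have := dvd_sub (h1.mul_left s) (h2.mul_left q)
      rwa [show s * (p * x + q * y) - q * (r * x + s * y) = x by linear_combination x * hd] at this
    · have := dvd_sub (h2.mul_left p) (h1.mul_left r)
      rwa [show p * (r * x + s * y) - r * (p * x + q * y) = y by linear_combination y * hd] at this
  · apply Int.natCast_dvd_natCast.1
    have h1 : ((Int.gcd x y : ℕ) : ℤ) ∣ _ := Int.gcd_dvd_left x y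
    have h2 : ((Int.gcd x y : ℕ) : ℤ) ∣ _ := Int.gcd_dvd_right x y
    exact Int.dvd_coe_gcd (dvd_add (h1.mul_left _) (h2.mul_left _))
      (dvd_add (h1.mul_left _) (h2.mul_left _))

/-- affine unimodular change of variables -/
lemma affine_count (p q r s t1 t2 : ℤ) (hd : p * s - q * r = 1 ∨ p * s - q * r = -1)
    (S S' : Set (ℤ × ℤ))
    (hS : ∀ x y : ℤ, (x, y) ∈ S' ↔ (p * x + q * y + t1, r * x + s * y + t2) ∈ S) :
    S'.ncard = S.ncard ∧ (S'.Finite → S.Finite) := by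
  have : ∃ ε : ℤ, ε * (p * s - q * r) = 1 := by
    rcases hd with h | h
    · exact ⟨1, by rw [h]; norm_num⟩
    · exact ⟨-1, by rw [h]; norm_num⟩
  obtain ⟨ε, hε⟩ := this
  have hS' : S = (fun z : ℤ × ℤ => (p * z.1 + q * z.2 + t1, r * z.1 + s * z.2 + t2)) '' S' := by
    ext ⟨x, y⟩
    simp only [Set.mem_image, Prod.mk.injEq, Prod.exists]
    constructor
    · intro h
      refine ⟨ε * (s * (x - t1) - q * (y - t2)), ε * (p * (y - t2) - r * (x - t1)), ?_, ?_, ?_⟩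
      · rw [hS]
        convert h using 2
        · linear_combination (x - t1) * hε
        · linear_combination (y - t2) * hε
      · linear_combination (x - t1) * hε
      · linear_combination (y - t2) * hε
    · rintro ⟨u, v, h, rfl, rfl⟩
      exact (hS u v).1 h
  have hinj : Function.Injective
      (fun z : ℤ × ℤ => (p * z.1 + q * z.2 + t1, r * z.1 + s * z.2 + t2)) := by
    rintro ⟨x, y⟩ ⟨u, v⟩ h
    simp only [Prod.mk.injEq] at h ⊢
    obtain ⟨h1, h2⟩ := h
    constructor
    · linear_combination ε * s * h1 - ε * q * h2 - (x - u) * hε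
    · linear_combination ε * p * h2 - ε * r * h1 - (y - v) * hε
  constructor
  · rw [hS', Set.ncard_image_of_injective _ hinj]
  · intro h; rw [hS']; exact h.image _

lemma pick1 (A C A2 C2 K : ℤ) (m : ℕ) (hK : K = A * C2 - C * A2) (hK0 : 0 < K) (S : Set (ℤ × ℤ))
    (hS : ∀ x y : ℤ, (x, y) ∈ S ↔ A2 * y - C2 * x < 0 ∧ 0 ≤ A * y - C * x ∧
      0 ≤ (A2 - A) * y - (C2 - C) * x + m * K) :
    S.Finite ∧ 2 * (S.ncard : ℤ) = (m : ℤ) ^ 2 * K - m * (Int.gcd A2 C2 : ℕ)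
      + m * (Int.gcd A C : ℕ) + m * (Int.gcd (A2 - A) (C2 - C) : ℕ) := by
  obtain ⟨g, hg⟩ : ∃ g : ℕ, g = Int.gcd A2 C2 := ⟨_, rfl⟩
  have hg0 : 0 < Int.gcd A2 C2 := by
    rw [Int.gcd_pos_iff]
    by_contra! hh
    rw [hh.1, hh.2] at hK
    simp at hK; omega
  obtain ⟨a0, c0, hco, ha, hc⟩ := Int.exists_gcd_one hg0
  rw [← hg] at ha hc hg0 ⊢
  have hgz : (0 : ℤ) < g := by exact_mod_cast hg0
  obtain ⟨u, v, huv⟩ := Int.isCoprime_iff_gcd_eq_one.2 hco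
  obtain ⟨q, hq⟩ : ∃ q, q = c0 * A - a0 * C := ⟨_, rfl⟩
  obtain ⟨r, hr⟩ : ∃ r, r = u * A + v * C := ⟨_, rfl⟩
  have hKq : K = g * q := by rw [hK, hq, ha, hc]; ring
  have hq0 : 0 < q := by rw [hKq] at hK0; exact pos_of_mul_pos_right hK0 hgz.le
  have hA : A = a0 * r + v * q := by rw [hr, hq]; linear_combination -A * huv
  have hC : C = c0 * r - u * q := by rw [hr, hq]; linear_combination -C * huv
  obtain ⟨e1, e2⟩ := affine_count a0 v c0 (-u) 0 0 (Or.inr (by linarith)) S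
    {z | (a0 * z.1 + v * z.2, c0 * z.1 - u * z.2) ∈ S} (by
      intro x y; simp only [Set.mem_ofPred_eq]
      rw [show a0 * x + v * y + 0 = a0 * x + v * y by ring,
        show c0 * x + -u * y + 0 = c0 * x - u * y by ring])
  obtain ⟨f1, f2⟩ := N1 g q r m hgz hq0 {z | (a0 * z.1 + v * z.2, c0 * z.1 - u * z.2) ∈ S} (by
    intro x z
    simp only [Set.mem_ofPred_eq]
    rw [hS]
    have i1 : A2 * (c0 * x - u * z) - C2 * (a0 * x + v * z) = -(g * z) := by
      rw [ha, hc]; linear_combination -g * z * huv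
    have i2 : A * (c0 * x - u * z) - C * (a0 * x + v * z) = q * x - r * z := by
      rw [hq, hr]; ring
    have i3 : (A2 - A) * (c0 * x - u * z) - (C2 - C) * (a0 * x + v * z) + m * K
        = m * q * g - (q * x + (g - r) * z) := by
      rw [hKq]; linear_combination i1 - i2
    rw [i1, i2, i3, sub_nonneg, sub_nonneg, neg_lt_zero, mul_pos_iff_of_pos_left hgz])
  refine ⟨e2 f1, ?_⟩
  rw [← e1, f2, hKq]
  have g1 : Int.gcd r q = Int.gcd A C := by
    have := gcd_inv u v (-c0) a0 A C (by linarith)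
    rw [← this, ← hr, show -c0 * A + a0 * C = -q by rw [hq]; ring, Int.gcd_neg]
  have g2 : Int.gcd (r - g) q = Int.gcd (A2 - A) (C2 - C) := by
    have := gcd_inv u v (-c0) a0 (A2 - A) (C2 - C) (by linarith)
    rw [← this, show -c0 * (A2 - A) + a0 * (C2 - C) = q by rw [hq, ha, hc]; ring,
      show u * (A2 - A) + v * (C2 - C) = -(r - g) by
        rw [hr, ha, hc]; linear_combination g * huv, Int.neg_gcd]
  rw [g1, g2]

lemma pick2 (A C A2 C2 K : ℤ) (m : ℕ) (hK : K = A * C2 - C * A2) (hK0 : K < 0) (hm : 0 < m)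
    (S : Set (ℤ × ℤ))
    (hS : ∀ x y : ℤ, (x, y) ∈ S ↔ 0 ≤ A2 * y - C2 * x ∧ A * y - C * x < 0 ∧
      (A2 - A) * y - (C2 - C) * x + m * K < 0) :
    S.Finite ∧ 2 * (S.ncard : ℤ) = -(m : ℤ) ^ 2 * K + m * (Int.gcd A2 C2 : ℕ)
      - m * (Int.gcd A C : ℕ) - m * (Int.gcd (A2 - A) (C2 - C) : ℕ) := by
  obtain ⟨g, hg⟩ : ∃ g : ℕ, g = Int.gcd A2 C2 := ⟨_, rfl⟩
  have hg0 : 0 < Int.gcd A2 C2 := by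
    rw [Int.gcd_pos_iff]
    by_contra! hh
    rw [hh.1, hh.2] at hK
    simp at hK; omega
  obtain ⟨a0, c0, hco, ha, hc⟩ := Int.exists_gcd_one hg0
  rw [← hg] at ha hc hg0 ⊢
  have hgz : (0 : ℤ) < g := by exact_mod_cast hg0
  obtain ⟨u, v, huv⟩ := Int.isCoprime_iff_gcd_eq_one.2 hco
  obtain ⟨q, hq⟩ : ∃ q, q = a0 * C - c0 * A := ⟨_, rfl⟩
  obtain ⟨r, hr⟩ : ∃ r, r = u * A + v * C := ⟨_, rfl⟩
  have hKq : -K = g * q := by rw [hK, hq, ha, hc]; ring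
  have hq0 : 0 < q := by
    have : 0 < g * q := by linarith
    exact pos_of_mul_pos_right this hgz.le
  obtain ⟨e1, e2⟩ := affine_count a0 (-v) c0 u 0 0 (Or.inl (by linarith)) S
    {z | (a0 * z.1 - v * z.2, c0 * z.1 + u * z.2) ∈ S} (by
      intro x y; simp only [Set.mem_ofPred_eq]
      rw [show a0 * x + -v * y + 0 = a0 * x - v * y by ring,
        show c0 * x + u * y + 0 = c0 * x + u * y by ring])
  obtain ⟨f1, f2⟩ := N2 g q r m hgz hq0 hm {z | (a0 * z.1 - v * z.2, c0 * z.1 + u * z.2) ∈ S} (by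
    intro x z
    simp only [Set.mem_ofPred_eq]
    rw [hS]
    have i1 : A2 * (c0 * x + u * z) - C2 * (a0 * x - v * z) = g * z := by
      rw [ha, hc]; linear_combination g * z * huv
    have i2 : A * (c0 * x + u * z) - C * (a0 * x - v * z) = r * z - q * x := by
      rw [hq, hr]; ring
    have i3 : (A2 - A) * (c0 * x + u * z) - (C2 - C) * (a0 * x - v * z) + m * K
        = (q * x + (g - r) * z) - m * q * g := by
      linear_combination i1 - i2 - m * hKq
    rw [i1, i2, i3, sub_neg, sub_neg, mul_nonneg_iff_of_pos_left hgz])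
  refine ⟨e2 f1, ?_⟩
  rw [← e1, f2]
  have g1 : Int.gcd r q = Int.gcd A C := by
    have := gcd_inv u v (-c0) a0 A C (by linarith)
    rw [← this, ← hr, show -c0 * A + a0 * C = q by rw [hq]; ring]
  have g2 : Int.gcd (g - r) q = Int.gcd (A2 - A) (C2 - C) := by
    have := gcd_inv u v (-c0) a0 (A2 - A) (C2 - C) (by linarith)
    rw [← this, show -c0 * (A2 - A) + a0 * (C2 - C) = -q by rw [hq, ha, hc]; ring,
      show u * (A2 - A) + v * (C2 - C) = g - r by
        rw [hr, ha, hc]; linear_combination g * huv, Int.gcd_neg]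
  rw [g1, g2]
  linear_combination -(m:ℤ)^2 * hKq

lemma gcd_collinear (A C B D : ℤ) (hC : 0 < C) (hD : 0 < D) (h : A * D = B * C) :
    Int.gcd A C + Int.gcd B D = Int.gcd (A + B) (C + D) := by
  have hg0 : 0 < Int.gcd A C := Int.gcd_pos_of_ne_zero_right _ hC.ne'
  obtain ⟨g, hg⟩ : ∃ g : ℕ, g = Int.gcd A C := ⟨_, rfl⟩
  obtain ⟨a0, c0, hco, ha, hc⟩ := Int.exists_gcd_one hg0
  rw [← hg] at ha hc hg0 ⊢
  have hgz : (0 : ℤ) < g := by exact_mod_cast hg0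
  have hc0 : 0 < c0 := by rw [hc] at hC; exact pos_of_mul_pos_left hC hgz.le
  have h1 : a0 * D = B * c0 := by
    rw [ha, hc] at h
    apply mul_left_cancel₀ hgz.ne'
    linarith
  have : c0 ∣ D := (Int.isCoprime_iff_gcd_eq_one.2 hco).symm.dvd_of_dvd_mul_left
    (by rw [h1]; exact dvd_mul_left _ _)
  obtain ⟨k, rfl⟩ := this
  have hk : 0 < k := pos_of_mul_pos_right hD hc0.le
  have hB : B = a0 * k := by
    apply mul_right_cancel₀ hc0.ne'
    linarith
  lift k to ℕ using hk.le
  rw [hB, ha, hc, ← mul_add, ← mul_add, Int.gcd_mul_right, Int.gcd_mul_right, hco]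
  simp only [one_mul]
  omega

/-- integer form of the dilated triangle -/
def TT (l A C m : ℤ) : Set (ℤ × ℤ) :=
  {p | 0 ≤ p.2 ∧ 0 ≤ A * p.2 - C * p.1 ∧ 0 ≤ C * m + l * C * p.1 - (1 + l * A) * p.2}

lemma mem_TT (l A C m x y : ℤ) : (x, y) ∈ TT l A C m ↔
    0 ≤ y ∧ 0 ≤ A * y - C * x ∧ 0 ≤ C * m + l * C * x - (1 + l * A) * y := Iff.rfl

lemma TT_finite (l A C m : ℤ) (hl : 0 < l) (hC : 0 < C) : (TT l A C m).Finite := by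
  have hlC : 0 < l * C := mul_pos hl hC
  refine (rows_count 0 (m * C) (fun y => -((C * m - (1 + l * A) * y) / (l * C)))
    (fun y => (A * y) / C) (TT l A C m) ?_).1
  intro x y
  rw [mem_TT, neg_le, ← le_div _ _ _ hlC, ← le_div _ _ _ hC]
  constructor
  · rintro ⟨h1, h2, h3⟩
    refine ⟨⟨h1, ?_⟩, ?_, ?_⟩
    · have := mul_nonneg hl.le h2
      linarith
    · linarith
    · linarith
  · rintro ⟨⟨h1, h2⟩, h3, h4⟩
    exact ⟨h1, by linarith, by linarith⟩

lemma ray_count (l A C b d : ℤ) (m : ℕ) (ln : ℕ) (hln : l = ln) (hl : 0 < l) (hC : 0 < C)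
    (hd : (1 + l * A) * d - b * (l * C) = 1) (R : Set (ℤ × ℤ))
    (hR : ∀ x y : ℤ, (x, y) ∈ R ↔ 0 ≤ y ∧ 0 ≤ A * y - C * x ∧
      (1 + l * A) * y - l * C * x - m * C = 0) :
    R.ncard = m / ln + 1 := by
  have : R = (((Finset.range (m / ln + 1)).image
      (fun j : ℕ => ((A * (m - l * j) - j, C * (m - l * j)) : ℤ × ℤ)) : Finset (ℤ × ℤ))
        : Set (ℤ × ℤ)) := by
    ext ⟨x, y⟩
    rw [hR]
    simp only [Finset.coe_image, Set.mem_image, Finset.mem_coe, Finset.mem_range, Prod.mk.injEq]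
    constructor
    · rintro ⟨h1, h2, h3⟩
      have hy : C ∣ y := ⟨d * (l * x + m) - b * l * y, by linear_combination d * h3 - y * hd⟩
      obtain ⟨k, rfl⟩ := hy
      have hk : 0 ≤ k := nonneg_of_mul_nonneg_right h1 hC
      have h4 : (1 + l * A) * k - l * x - m = 0 := by
        apply mul_left_cancel₀ hC.ne'
        linear_combination h3
      have h5 : 0 ≤ A * k - x := by
        have : 0 ≤ C * (A * k - x) := by linarith
        exact nonneg_of_mul_nonneg_right this hC
      refine ⟨(A * k - x).toNat, ?_, ?_, ?_⟩
      · rw [Nat.lt_succ_iff, Nat.le_div_iff_mul_le (by omega)]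
        zify
        rw [Int.toNat_of_nonneg h5, ← hln]
        linarith
      · rw [Int.toNat_of_nonneg h5]
        linear_combination -A * h4
      · rw [Int.toNat_of_nonneg h5]
        linear_combination -C * h4
    · rintro ⟨j, hj, rfl, rfl⟩
      rw [Nat.lt_succ_iff, Nat.le_div_iff_mul_le (by omega)] at hj
      have hj' : l * j ≤ m := by rw [hln]; exact_mod_cast (by linarith : ln * j ≤ m)
      refine ⟨mul_nonneg hC.le (by linarith), ?_, by ring⟩
      have : 0 ≤ C * (j : ℤ) := by positivity
      linarith
  rw [this, Set.ncard_coe_finset, Finset.card_image_of_injective, Finset.card_range]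
  intro i j h
  simp only [Prod.mk.injEq] at h
  have h1 := mul_left_cancel₀ hC.ne' h.2
  have h2 : l * (i : ℤ) = l * j := by linarith
  exact_mod_cast mul_left_cancel₀ hl.ne' h2

lemma sgn_nonneg {C X : ℤ} (hC : 0 < C) (h : 0 ≤ C * X) : 0 ≤ X := nonneg_of_mul_nonneg_right h hC

lemma sgn_neg {C X : ℤ} (hC : 0 < C) (h : C * X < 0) : X < 0 := by
  by_contra! hh
  have := mul_nonneg hC.le hh
  linarith

lemma main_int (l A C A' C' A2 C2 b d K : ℤ) (m ln : ℕ) (hln : l = ln) (hl : 0 < l)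
    (hC : 0 < C) (hC' : 0 < C') (hC2 : 0 < C2)
    (hd : (1 + l * A) * d - b * (l * C) = 1)
    (hA2 : A2 = A + (1 + l * A) * A' + b * C') (hC2e : C2 = C + l * C * A' + d * C')
    (hK : K = A * C2 - C * A2) :
    l * K = C + C' - C2 ∧
    2 * ((TT l A2 C2 m).ncard : ℤ) = 2 * ((TT l A C m).ncard : ℤ) + 2 * ((TT l A' C' m).ncard : ℤ)
      - (m : ℤ) ^ 2 * K
      - m * ((Int.gcd A C : ℕ) + (Int.gcd A' C' : ℕ) - (Int.gcd A2 C2 : ℕ))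
      - 2 * ((m / ln + 1 : ℕ) : ℤ) := by
  have hlK : l * K = C + C' - C2 := by
    rw [hK, hA2, hC2e]; linear_combination C' * hd
  refine ⟨hlK, ?_⟩
  obtain ⟨S2, hS2⟩ : ∃ S2 : Set (ℤ × ℤ), ∀ x y : ℤ, (x, y) ∈ S2 ↔
      0 ≤ (1 + l * A) * y - l * C * x - m * C ∧
      0 ≤ (A2 - A) * y - (C2 - C) * x + m * K ∧
      0 ≤ C2 * m + l * C2 * x - (1 + l * A2) * y :=
    ⟨{p | 0 ≤ (1 + l * A) * p.2 - l * C * p.1 - m * C ∧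
      0 ≤ (A2 - A) * p.2 - (C2 - C) * p.1 + m * K ∧
      0 ≤ C2 * m + l * C2 * p.1 - (1 + l * A2) * p.2}, fun _ _ => Iff.rfl⟩
  -- the change of variables
  obtain ⟨cS2, -⟩ := affine_count d (-b) (-(l * C)) (1 + l * A) (-d * m * A + b * m * C) (-(m * C))
    (Or.inl (by linarith)) (TT l A' C' m) S2 (by
      intro x y
      rw [hS2, mem_TT]
      have i1 : -(l * C) * x + (1 + l * A) * y + -(m * C)
        = (1 + l * A) * y - l * C * x - m * C := by ring
      have i2 : A' * (-(l * C) * x + (1 + l * A) * y + -(m * C))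
          - C' * (d * x + -b * y + (-d * m * A + b * m * C))
          = (A2 - A) * y - (C2 - C) * x + m * K := by
        rw [hK, hA2, hC2e]; ring
      have i3 : C' * m + l * C' * (d * x + -b * y + (-d * m * A + b * m * C))
          - (1 + l * A') * (-(l * C) * x + (1 + l * A) * y + -(m * C))
          = C2 * m + l * C2 * x - (1 + l * A2) * y := by
        linear_combination -l * i2 - m * hlK
      rw [i2, i3, i1])
  have cS2f : S2.Finite := by
    have hT := TT_finite l A' C' m hl hC'
    obtain ⟨-, k⟩ := affine_count (1 + l * A) b (l * C) d (m * A) (m * C)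
      (Or.inl (by linarith)) S2 (TT l A' C' m) (by
        intro x y
        rw [hS2, mem_TT]
        have i1 : (1 + l * A) * (l * C * x + d * y + m * C)
            - l * C * ((1 + l * A) * x + b * y + m * A) - m * C = y := by
          linear_combination y * hd
        have i2 : (A2 - A) * (l * C * x + d * y + m * C)
            - (C2 - C) * ((1 + l * A) * x + b * y + m * A) + m * K = A' * y - C' * x := by
          rw [hK, hA2, hC2e]; linear_combination (A' * y - C' * x) * hd
        have i3 : C2 * m + l * C2 * ((1 + l * A) * x + b * y + m * A)
            - (1 + l * A2) * (l * C * x + d * y + m * C)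
            = C' * m + l * C' * x - (1 + l * A') * y := by
          linear_combination -l * i2 - i1 + m * hlK
        rw [i1, i2, i3])
    exact k hT
  have fS := TT_finite l A C m hl hC
  have fS'' := TT_finite l A2 C2 m hl hC2
  -- pointwise identities
  have D1 : ∀ x y : ℤ, C2 * (A * y - C * x) = C * (A2 * y - C2 * x) + K * y := by
    intro x y; rw [hK]; ring
  have R4 : ∀ x y : ℤ, C2 * ((1 + l * A) * y - l * C * x - m * C)
      = C' * y - C * (C2 * m + l * C2 * x - (1 + l * A2) * y) := by
    intro x y; linear_combination -l * y * hK + y * hlK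
  have D2 : ∀ x y : ℤ, C2 * ((A2 - A) * y - (C2 - C) * x + m * K)
      = C' * (A2 * y - C2 * x) + K * (C2 * m + l * C2 * x - (1 + l * A2) * y) := by
    intro x y
    linear_combination (A2 * y - C2 * x) * hlK + y * hK
  have D3 : ∀ x y : ℤ, C * ((A2 - A) * y - (C2 - C) * x + m * K)
      = C' * (A * y - C * x) - K * ((1 + l * A) * y - l * C * x - m * C) := by
    intro x y
    linear_combination (A * y - C * x) * hlK + y * hK
  have hg12 : Int.gcd (A2 - A) (C2 - C) = Int.gcd A' C' := by
    have := gcd_inv (1 + l * A) b (l * C) d A' C' (by linarith)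
    rw [← this, hA2, hC2e]; congr 1 <;> ring
  have hRay : (TT l A C m ∩ S2).ncard = m / ln + 1 := by
    apply ray_count l A C b d m ln hln hl hC hd
    intro x y
    rw [Set.mem_inter_iff, mem_TT, hS2]
    constructor
    · rintro ⟨⟨h1, h2, h3⟩, h4, h5, h6⟩
      exact ⟨h1, h2, by linarith⟩
    · rintro ⟨h1, h2, h3⟩
      have r4 := R4 x y
      have d3 := D3 x y
      rw [h3] at r4 d3
      refine ⟨⟨h1, h2, by linarith⟩, by linarith, ?_, ?_⟩
      · apply sgn_nonneg hC
        have := mul_nonneg hC'.le h2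
        linarith
      · apply sgn_nonneg hC
        have := mul_nonneg hC'.le h1
        linarith
  have hun := Set.ncard_union_add_ncard_inter (TT l A C m) S2 fS cS2f
  rw [hRay, cS2] at hun
  rcases lt_or_ge 0 K with hK0 | hK0
  · obtain ⟨P, hP⟩ : ∃ P : Set (ℤ × ℤ), ∀ x y : ℤ, (x, y) ∈ P ↔ A2 * y - C2 * x < 0 ∧
        0 ≤ A * y - C * x ∧ 0 ≤ (A2 - A) * y - (C2 - C) * x + m * K :=
      ⟨{p | A2 * p.2 - C2 * p.1 < 0 ∧ 0 ≤ A * p.2 - C * p.1 ∧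
        0 ≤ (A2 - A) * p.2 - (C2 - C) * p.1 + m * K}, fun _ _ => Iff.rfl⟩
    obtain ⟨fP, cP⟩ := pick1 A C A2 C2 K m hK hK0 P hP
    have hU : TT l A C m ∪ S2 = TT l A2 C2 m ∪ P := by
      ext ⟨x, y⟩
      rw [Set.mem_union, Set.mem_union, mem_TT, mem_TT, hS2, hP]
      have d1 := D1 x y
      have d2 := D2 x y
      have d3 := D3 x y
      have r4 := R4 x y
      have e12 : (A2 - A) * y - (C2 - C) * x + m * K
        = (A2 * y - C2 * x) - (A * y - C * x) + m * K := by ring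
      have hβ : C * m + l * C * x - (1 + l * A) * y = -((1 + l * A) * y - l * C * x - m * C) := by
        ring
      rw [hβ]
      generalize (A2 - A) * y - (C2 - C) * x + m * K = E12 at *
      generalize A2 * y - C2 * x = E02 at *
      generalize A * y - C * x = E01 at *
      generalize C2 * m + l * C2 * x - (1 + l * A2) * y = δ at *
      generalize (1 + l * A) * y - l * C * x - m * C = β at *
      constructor
      · rintro (⟨h1, h2, h3⟩ | ⟨h1, h2, h3⟩)
        · have hδ : 0 ≤ δ := by
            apply sgn_nonneg hC
            have := mul_nonneg hC'.le h1
            have := mul_nonneg hC2.le h3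
            linarith
          have h12 : 0 ≤ E12 := by
            apply sgn_nonneg hC
            have := mul_nonneg hC'.le h2
            have := mul_nonneg hK0.le h3
            linarith
          rcases lt_or_ge E02 0 with h | h
          · exact Or.inr ⟨h, h2, h12⟩
          · exact Or.inl ⟨h1, h, hδ⟩
        · have hα : 0 ≤ y := by
            apply sgn_nonneg hC'
            have := mul_nonneg hC.le h3
            have := mul_nonneg hC2.le h1
            linarith
          have h01 : 0 ≤ E01 := by
            apply sgn_nonneg hC'
            have := mul_nonneg hC.le h2
            have := mul_nonneg hK0.le h1
            linarith
          rcases lt_or_ge E02 0 with h | h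
          · exact Or.inr ⟨h, h01, h2⟩
          · exact Or.inl ⟨hα, h, h3⟩
      · rintro (⟨h1, h2, h3⟩ | ⟨h1, h2, h3⟩)
        · have h01 : 0 ≤ E01 := by
            apply sgn_nonneg hC2
            have := mul_nonneg hC.le h2
            have := mul_nonneg hK0.le h1
            linarith
          have h12 : 0 ≤ E12 := by
            apply sgn_nonneg hC2
            have := mul_nonneg hC'.le h2
            have := mul_nonneg hK0.le h3
            linarith
          rcases le_total 0 β with h | h
          · exact Or.inr ⟨h, h12, h3⟩
          · exact Or.inl ⟨h1, h01, by linarith⟩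
        · have hα : 0 ≤ y := by
            apply sgn_nonneg hK0
            have := mul_nonneg hC2.le h2
            have := mul_pos hC (neg_pos.2 h1)
            linarith
          have hδ : 0 ≤ δ := by
            apply sgn_nonneg hK0
            have := mul_nonneg hC2.le h3
            have := mul_pos hC' (neg_pos.2 h1)
            linarith
          rcases le_total 0 β with h | h
          · exact Or.inr ⟨h, h3, hδ⟩
          · exact Or.inl ⟨hα, h2, by linarith⟩
    have hdis : Disjoint (TT l A2 C2 m) P := by
      rw [Set.disjoint_left]
      rintro ⟨x, y⟩ h1 h2
      rw [mem_TT] at h1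
      rw [hP] at h2
      linarith [h1.2.1, h2.1]
    rw [hU, Set.ncard_union_eq hdis fS'' fP] at hun
    rw [hg12] at cP
    zify at hun
    push_cast at hun ⊢
    linear_combination 2 * hun - cP
  · obtain ⟨P, hP⟩ : ∃ P : Set (ℤ × ℤ), ∀ x y : ℤ, (x, y) ∈ P ↔ 0 ≤ A2 * y - C2 * x ∧
        A * y - C * x < 0 ∧ (A2 - A) * y - (C2 - C) * x + m * K < 0 :=
      ⟨{p | 0 ≤ A2 * p.2 - C2 * p.1 ∧ A * p.2 - C * p.1 < 0 ∧
        (A2 - A) * p.2 - (C2 - C) * p.1 + m * K < 0}, fun _ _ => Iff.rfl⟩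
    have hPick : P.Finite ∧ 2 * (P.ncard : ℤ) = -(m : ℤ) ^ 2 * K + m * (Int.gcd A2 C2 : ℕ)
      - m * (Int.gcd A C : ℕ) - m * (Int.gcd (A2 - A) (C2 - C) : ℕ) := by
      by_cases h0 : m = 0 ∨ K = 0
      · have hmK : m * K = 0 := by
          rcases h0 with h0 | h0 <;> simp [h0]
        have hPe : P = ∅ := by
          rw [Set.eq_empty_iff_forall_notMem]
          rintro ⟨x, y⟩ hxy
          rw [hP] at hxy
          obtain ⟨h1, h2, h3⟩ := hxy
          linarith
        refine ⟨by rw [hPe]; exact Set.finite_empty, ?_⟩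
        rw [hPe, Set.ncard_empty]
        rcases h0 with h0 | h0
        · simp [h0]
        · have := gcd_collinear A C (A2 - A) (C2 - C) hC (by rw [h0] at hlK; linarith)
            (by linarith)
          rw [add_sub_cancel, add_sub_cancel] at this
          rw [← this, h0]
          push_cast
          ring
      · push Not at h0
        exact pick2 A C A2 C2 K m hK (lt_of_le_of_ne hK0 h0.2) (Nat.pos_of_ne_zero h0.1) P hP
    obtain ⟨fP, cP⟩ := hPick
    have hU : TT l A2 C2 m = (TT l A C m ∪ S2) ∪ P := by
      ext ⟨x, y⟩
      rw [Set.mem_union, Set.mem_union, mem_TT, mem_TT, hS2, hP]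
      have d1 := D1 x y
      have d2 := D2 x y
      have d3 := D3 x y
      have r4 := R4 x y
      have hβ : C * m + l * C * x - (1 + l * A) * y = -((1 + l * A) * y - l * C * x - m * C) := by
        ring
      have e12 : (A2 - A) * y - (C2 - C) * x + m * K
        = (A2 * y - C2 * x) - (A * y - C * x) + m * K := by ring
      have hmK : m * K ≤ 0 := mul_nonpos_of_nonneg_of_nonpos (by positivity) hK0
      rw [hβ]
      generalize (A2 - A) * y - (C2 - C) * x + m * K = E12 at *
      generalize A2 * y - C2 * x = E02 at *
      generalize A * y - C * x = E01 at *
      generalize C2 * m + l * C2 * x - (1 + l * A2) * y = δ at *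
      generalize (1 + l * A) * y - l * C * x - m * C = β at *
      constructor
      · rintro ⟨h1, h2, h3⟩
        rcases le_total 0 β with h | h
        · rcases lt_or_ge E12 0 with h' | h'
          · right
            refine ⟨h2, ?_, h'⟩
            apply sgn_neg hC'
            have := mul_neg_of_pos_of_neg hC h'
            have := mul_nonpos_of_nonpos_of_nonneg hK0 h
            linarith
          · exact Or.inl (Or.inr ⟨h, h', h3⟩)
        · rcases lt_or_ge E01 0 with h' | h'
          · right
            refine ⟨h2, h', ?_⟩
            apply sgn_neg hC
            have := mul_neg_of_pos_of_neg hC' h'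
            have := mul_nonneg_of_nonpos_of_nonpos hK0 h
            linarith
          · exact Or.inl (Or.inl ⟨h1, h', by linarith⟩)
      · rintro ((⟨h1, h2, h3⟩ | ⟨h1, h2, h3⟩) | ⟨h1, h2, h3⟩)
        · refine ⟨h1, ?_, ?_⟩
          · apply sgn_nonneg hC
            have := mul_nonneg hC2.le h2
            have := mul_nonpos_of_nonpos_of_nonneg hK0 h1
            linarith
          · apply sgn_nonneg hC
            have := mul_nonneg hC'.le h1
            have := mul_nonneg hC2.le h3
            linarith
        · refine ⟨?_, ?_, h3⟩
          · apply sgn_nonneg hC'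
            have := mul_nonneg hC.le h3
            have := mul_nonneg hC2.le h1
            linarith
          · apply sgn_nonneg hC'
            have := mul_nonneg hC2.le h2
            have := mul_nonpos_of_nonpos_of_nonneg hK0 h3
            linarith
        · refine ⟨?_, h1, ?_⟩
          · by_contra! hh
            have := mul_nonneg_of_nonpos_of_nonpos hK0 hh.le
            have := mul_nonneg hC.le h1
            have := mul_neg_of_pos_of_neg hC2 h2
            linarith
          · by_contra! hh
            have := mul_nonneg_of_nonpos_of_nonpos hK0 hh.le
            have := mul_nonneg hC'.le h1
            have := mul_neg_of_pos_of_neg hC2 h3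
            linarith
    have hdis : Disjoint (TT l A C m ∪ S2) P := by
      rw [Set.disjoint_left]
      rintro ⟨x, y⟩ h1 h2
      rw [Set.mem_union, mem_TT, hS2] at h1
      rw [hP] at h2
      rcases h1 with h1 | h1
      · linarith [h1.2.1, h2.2.1]
      · linarith [h1.2.1, h2.2.2]
    rw [hU, Set.ncard_union_eq hdis (fS.union cS2f) fP]
    rw [hg12] at cP
    zify at hun
    push_cast at hun ⊢
    linear_combination 2 * hun + cP

lemma mem_smul_Tri (a c : ℤ) (t : ℝ) (hc : 0 < c) (ht : 0 ≤ t) (x y : ℝ) :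
    (x, y) ∈ t • Tri a c ↔ 0 ≤ y ∧ 0 ≤ ((a : ℝ) - 1) * y - c * x ∧ 0 ≤ c * (x + t) - a * y := by
  have hcR : (0 : ℝ) < c := by exact_mod_cast hc
  constructor
  · intro h
    obtain ⟨⟨X, Y⟩, hp, hxy⟩ := Set.mem_smul_set.1 h
    have hsub : Tri a c ⊆ {p : ℝ × ℝ | 0 ≤ p.2 ∧ 0 ≤ ((a : ℝ) - 1) * p.2 - c * p.1 ∧
        0 ≤ c * (p.1 + 1) - a * p.2} := by
      apply convexHull_min
      · rintro p hp
        simp only [Set.mem_insert_iff, Set.mem_singleton_iff] at hp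
        rcases hp with rfl | rfl | rfl
        · exact ⟨by simp, by simp, by simp; exact hc.le⟩
        · refine ⟨hcR.le, le_of_eq ?_, le_of_eq ?_⟩ <;> simp <;> ring
        · refine ⟨by simp, by simp; exact hc.le, by simp⟩
      · rintro ⟨p1, p2⟩ ⟨hp1, hp2, hp3⟩ ⟨q1, q2⟩ ⟨hq1, hq2, hq3⟩ u v hu hv huv
        simp only at hp1 hp2 hp3 hq1 hq2 hq3
        refine ⟨?_, ?_, ?_⟩
        · simp only [Prod.smul_mk, Prod.mk_add_mk, smul_eq_mul]
          positivity
        · simp only [Prod.smul_mk, Prod.mk_add_mk, smul_eq_mul]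
          have := mul_nonneg hu hp2
          have := mul_nonneg hv hq2
          linarith
        · simp only [Prod.smul_mk, Prod.mk_add_mk, smul_eq_mul]
          have := mul_nonneg hu hp3
          have := mul_nonneg hv hq3
          have e : (c : ℝ) * (u * p1 + v * q1 + 1) = c * (u * p1 + v * q1 + (u + v)) := by rw [huv]
          rw [e]
          linarith
    obtain ⟨h1, h2, h3⟩ := hsub hp
    simp only at h1 h2 h3
    simp only [Prod.smul_mk, smul_eq_mul, Prod.mk.injEq] at hxy
    obtain ⟨rfl, rfl⟩ := hxy
    have := mul_nonneg ht h2
    have := mul_nonneg ht h3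
    exact ⟨mul_nonneg ht h1, by linarith, by linarith⟩
  · rintro ⟨h1, h2, h3⟩
    rcases ht.eq_or_lt with rfl | ht
    · have hy : y = 0 := by linarith
      subst hy
      have hx : x = 0 := by nlinarith
      subst hx
      refine Set.mem_smul_set.2 ⟨(0, 0), subset_convexHull ℝ _ (by simp), by ext <;> simp⟩
    · have htc : 0 < t * c := mul_pos ht hcR
      refine Set.mem_smul_set.2 ⟨(x / t, y / t), ?_, by
        simp only [Prod.smul_mk, smul_eq_mul]; field_simp⟩
      have := (convex_convexHull ℝ {((0 : ℝ), (0 : ℝ)), (((a : ℝ) - 1), (c : ℝ)),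
        ((-1 : ℝ), (0 : ℝ))}).sum_mem (t := (Finset.univ : Finset (Fin 3)))
        (w := ![(c * (x + t) - a * y) / (t * c), y / (t * c),
          (((a : ℝ) - 1) * y - c * x) / (t * c)])
        (z := ![((0 : ℝ), (0 : ℝ)), (((a : ℝ) - 1), (c : ℝ)), ((-1 : ℝ), (0 : ℝ))])
        (by
          intro i _
          fin_cases i
          · exact div_nonneg h3 htc.le
          · exact div_nonneg h1 htc.le
          · exact div_nonneg h2 htc.le)
        (by
          simp only [Fin.sum_univ_three, Matrix.cons_val]
          field_simp
          ring)
        (by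
          intro i _
          apply subset_convexHull
          fin_cases i <;> simp)
      have e : (x / t, y / t) = ∑ i : Fin 3, (![(c * (x + t) - a * y) / (t * c), y / (t * c),
          (((a : ℝ) - 1) * y - c * x) / (t * c)] : Fin 3 → ℝ) i •
        (![((0 : ℝ), (0 : ℝ)), (((a : ℝ) - 1), (c : ℝ)), ((-1 : ℝ), (0 : ℝ))] : Fin 3 → ℝ × ℝ) i := by
        simp only [Fin.sum_univ_three, Matrix.cons_val, Prod.smul_mk, Prod.mk_add_mk, smul_eq_mul,
          Prod.mk.injEq]
        constructor
        · field_simp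
          ring
        · field_simp
          ring
      rw [Tri, e]
      exact this

lemma latticeCount_eq (A C : ℤ) (ln m : ℕ) (hl : 0 < ln) (hC : 0 < C) :
    latticeCount (((m : ℝ) / (ln : ℝ)) • Tri (1 + ln * A) (ln * C)) = (TT ln A C m).ncard := by
  have hlR : (0 : ℝ) < ln := by exact_mod_cast hl
  have hlZ : (0 : ℤ) < ln := by exact_mod_cast hl
  unfold latticeCount
  congr 1
  ext ⟨x, y⟩
  rw [mem_TT]
  change ((x : ℝ), (y : ℝ)) ∈ ((m : ℝ) / (ln : ℝ)) • Tri (1 + ln * A) (ln * C) ↔ _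
  rw [mem_smul_Tri _ _ _ (mul_pos hlZ hC) (by positivity)]
  push_cast
  have e1 : (1 + (ln : ℝ) * A - 1) * y - ln * C * x = ln * (((A * y - C * x : ℤ)) : ℝ) := by
    push_cast; ring
  have e2 : (ln : ℝ) * C * (x + m / ln) - (1 + ln * A) * y
      = ((C * m + ln * C * x - (1 + ln * A) * y : ℤ) : ℝ) := by
    push_cast; field_simp; ring
  rw [e1, e2, mul_nonneg_iff_of_pos_left hlR, Int.cast_nonneg_iff, Int.cast_nonneg_iff,
    Int.cast_nonneg_iff]

/-- **Theorem (Statement 1).** Summation formula for 0th Ehrhart coefficients. -/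
theorem statement1 (a b c d a' b' c' d' : ℤ)
    (h : a * d - b * c = 1) (h' : a' * d' - b' * c' = 1)
    (hc : 0 < c) (hc' : 0 < c') (hcc : 0 < c * a' + d * c') (m : ℕ) :
    G0 (a * a' + b * c') (c * a' + d * c')
        (Int.gcd (c * a' + d * c') (a * a' + b * c' - 1))
        (Nat.gcd (Int.gcd c (a - 1)) (Int.gcd c' (a' - 1))) m
      = G0 a c (Int.gcd c (a - 1))
          (Nat.gcd (Int.gcd c (a - 1)) (Int.gcd c' (a' - 1))) m
        + G0 a' c' (Int.gcd c' (a' - 1))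
            (Nat.gcd (Int.gcd c (a - 1)) (Int.gcd c' (a' - 1))) m
        + Int.fract ((m : ℝ) / (Nat.gcd (Int.gcd c (a - 1)) (Int.gcd c' (a' - 1)) : ℝ))
        - 1 := by
  obtain ⟨ln, hln⟩ : ∃ ln, ln = Nat.gcd (Int.gcd c (a - 1)) (Int.gcd c' (a' - 1)) := ⟨_, rfl⟩
  have hl0 : 0 < ln := by
    rw [hln]
    exact Nat.gcd_pos_of_pos_left _ (Int.gcd_pos_of_ne_zero_left _ hc.ne')
  have d1 : (ln : ℤ) ∣ (Int.gcd c (a - 1) : ℕ) := by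
    rw [hln]; exact_mod_cast Nat.gcd_dvd_left _ _
  have d2 : (ln : ℤ) ∣ (Int.gcd c' (a' - 1) : ℕ) := by
    rw [hln]; exact_mod_cast Nat.gcd_dvd_right _ _
  obtain ⟨C, hC⟩ := d1.trans (Int.gcd_dvd_left _ _)
  obtain ⟨A, hA⟩ := d1.trans (Int.gcd_dvd_right _ _)
  obtain ⟨C', hC'⟩ := d2.trans (Int.gcd_dvd_left _ _)
  obtain ⟨A', hA'⟩ := d2.trans (Int.gcd_dvd_right _ _)
  rw [← hln]
  clear hln d1 d2
  have hlZ : (0 : ℤ) < ln := by exact_mod_cast hl0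
  have hlR : (0 : ℝ) < ln := by exact_mod_cast hl0
  have hA1 : a = 1 + ln * A := by linarith
  have hA1' : a' = 1 + ln * A' := by linarith
  subst hC hC' hA1 hA1'
  clear hA hA' h'
  obtain ⟨A2, hA2⟩ : ∃ A2, A2 = A + (1 + ln * A) * A' + b * C' := ⟨_, rfl⟩
  obtain ⟨C2, hC2⟩ : ∃ C2, C2 = C + ln * C * A' + d * C' := ⟨_, rfl⟩
  have ea : (1 + ln * A) * (1 + ln * A') + b * (ln * C') = 1 + ln * A2 := by rw [hA2]; ring
  have ec : ln * C * (1 + ln * A') + d * (ln * C') = ln * C2 := by rw [hC2]; ring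
  rw [ea, ec]
  rw [ec] at hcc
  have pC := pos_of_mul_pos_right hc hlZ.le
  have pC' := pos_of_mul_pos_right hc' hlZ.le
  have pC2 := pos_of_mul_pos_right hcc hlZ.le
  obtain ⟨hlK, key⟩ := main_int ln A C A' C' A2 C2 b d _ m ln rfl hlZ pC pC' pC2 h hA2 hC2 rfl
  have eg : ∀ A C : ℤ, Int.gcd (ln * C) (1 + ln * A - 1) = ln * Int.gcd A C := by
    intro A C
    rw [add_sub_cancel_left, Int.gcd_mul_left, Int.gcd_comm]
    simp
  have eG : ∀ A C : ℤ, 0 < C → G0 (1 + ln * A) (ln * C) (ln * Int.gcd A C) ln m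
      = ((TT ln A C m).ncard : ℝ) - C * m ^ 2 / (2 * ln) - (Int.gcd A C : ℝ) * m / 2 - m / ln := by
    intro A C hC
    rw [G0, latticeCount_eq A C ln m hl0 hC]
    push_cast
    field_simp
    ring
  rw [eg, eg, eg, eG _ _ pC, eG _ _ pC', eG _ _ pC2]
  have hfr : Int.fract ((m : ℝ) / ln) = m / ln - ((m / ln : ℕ) : ℝ) := by
    rw [Int.fract]
    congr 1
    rw [← natCast_floor_eq_intCast_floor (by positivity), Nat.floor_div_eq_div]
  rw [hfr]
  clear hfr
  generalize m / ln = k at key ⊢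
  have keyR := congrArg (Int.cast : ℤ → ℝ) key
  have hlKR := congrArg (Int.cast : ℤ → ℝ) hlK
  push_cast at keyR hlKR
  have hK' : ((A : ℝ) * C2 - C * A2) = (C + C' - C2) / ln := by
    rw [eq_div_iff hlR.ne']; linarith
  rw [hK'] at keyR
  have e3 : ∀ z : ℝ, z * m ^ 2 / (2 * ln) = (m : ℝ) ^ 2 * (z / ln) / 2 := by
    intro z; field_simp
  rw [e3, e3, e3]
  rw [sub_div, add_div] at keyR
  linear_combination keyR / 2
end

section
/- Let γ=((a,b),(c,d)) ∈ SL₂(ℤ) with c>0 and ℓ_γ := gcd(c,a−1), and let x₁ ∈ ℓ_γ⁻¹ℤ ∖ ℤ. Then #(ℤ² ∩ int T_{γ,x}) = ({x₁}/2)·(c{x₁} + 1 + c − ℓ_γ) − Σ_{m=1}^{c{x₁}} {m·d/c}, where c{x₁} is a positive integer. -/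
open scoped Pointwise Classical
open MeasureTheory

lemma tri_eq (a c : ℤ) (hc : 0 < c) (t : ℝ) (ht : 0 < t) :
    t • Tri a c = {p : ℝ × ℝ | 0 ≤ p.2 ∧ 0 ≤ ((a:ℝ) - 1) * p.2 - c * p.1 ∧
      -(t * c) ≤ (c * p.1 - a * p.2)} := by
  have hcR : (0:ℝ) < c := by exact_mod_cast hc
  apply Set.Subset.antisymm
  · unfold Tri
    rw [← convexHull_smul]
    apply convexHull_min
    · intro p hp
      simp only [Set.smul_set_insert, Set.smul_set_singleton, Set.mem_insert_iff,
        Set.mem_singleton_iff] at hp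
      have h1 : 0 < t * c := by positivity
      rcases hp with rfl | rfl | rfl <;> simp <;> (try constructor) <;> (try constructor) <;> nlinarith
    · intro p hp q hq u v hu hv huv
      obtain ⟨h1, h2, h3⟩ := hp
      obtain ⟨k1, k2, k3⟩ := hq
      have e : u = 1 - v := by linarith
      refine ⟨?_, ?_, ?_⟩
      · simp only [Prod.snd_add, Prod.smul_snd, smul_eq_mul]; positivity
      · simp only [Prod.snd_add, Prod.smul_snd, smul_eq_mul, Prod.fst_add, Prod.smul_fst]
        nlinarith [mul_nonneg hu h2, mul_nonneg hv k2]
      · simp only [Prod.snd_add, Prod.smul_snd, smul_eq_mul, Prod.fst_add, Prod.smul_fst]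
        have := mul_le_mul_of_nonneg_left h3 hu
        have := mul_le_mul_of_nonneg_left k3 hv
        have : u * (-(t*c)) + v * (-(t*c)) = -(t*c) := by rw [← add_mul, huv, one_mul]
        linarith
  · rintro ⟨x, y⟩ ⟨h1, h2, h3⟩
    simp only at h1 h2 h3
    rw [Set.mem_smul_set]
    refine ⟨(x / t, y / t), ?_, ?_⟩
    · unfold Tri
      have hconv := convex_convexHull ℝ
        {((0 : ℝ), (0 : ℝ)), (((a : ℝ) - 1), (c : ℝ)), ((-1 : ℝ), (0 : ℝ))}
      have hs := subset_convexHull ℝ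
        {((0 : ℝ), (0 : ℝ)), (((a : ℝ) - 1), (c : ℝ)), ((-1 : ℝ), (0 : ℝ))}
      have := hconv.sum_mem (t := Finset.univ)
        (w := ![(t * c + (c * x - a * y)) / (t * c), y / (t * c), (((a:ℝ)-1) * y - c * x) / (t * c)])
        (z := ![((0 : ℝ), (0 : ℝ)), (((a : ℝ) - 1), (c : ℝ)), ((-1 : ℝ), (0 : ℝ))])
        ?_ ?_ ?_
      · convert this using 1
        simp [Fin.sum_univ_three]
        constructor <;> field_simp <;> ring
      · intro i _
        fin_cases i
        · exact div_nonneg (by linarith) (by positivity)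
        · exact div_nonneg (by linarith) (by positivity)
        · exact div_nonneg (by linarith) (by positivity)
      · simp [Fin.sum_univ_three]
        field_simp; ring
      · intro i _
        apply hs
        fin_cases i <;> simp
    · ext <;> simp <;> field_simp

lemma interior_tri (a c : ℤ) (hc : 0 < c) (t : ℝ) (ht : 0 < t) :
    interior (t • Tri a c) = {p : ℝ × ℝ | 0 < p.2 ∧ 0 < ((a:ℝ) - 1) * p.2 - c * p.1 ∧
      -(t * c) < (c * p.1 - a * p.2)} := by
  have hcR : (c:ℝ) ≠ 0 := by exact_mod_cast hc.ne'
  have e : t • Tri a c = {p : ℝ × ℝ | 0 ≤ 0 * p.1 + 1 * p.2} ∩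
     ({p : ℝ × ℝ | 0 ≤ (-c:ℝ) * p.1 + ((a:ℝ) - 1) * p.2} ∩
      {p : ℝ × ℝ | -(t * c) ≤ (c:ℝ) * p.1 + (-a:ℝ) * p.2}) := by
    rw [tri_eq a c hc t ht]
    ext p
    simp only [Set.mem_ofPred_eq, Set.mem_inter_iff]
    refine and_congr (by ring_nf) (and_congr (by ring_nf) (by ring_nf))
  rw [e, interior_inter, interior_inter, interior_half _ _ _ (by simp),
    interior_half _ _ _ (by simp [hcR]), interior_half _ _ _ (by simp [hcR])]
  ext p
  simp only [Set.mem_ofPred_eq, Set.mem_inter_iff]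
  refine and_congr (by ring_nf) (and_congr (by ring_nf) (by ring_nf))

lemma dual (c N : ℕ) [NeZero c] (hN : 0 < N) (hNc : N < c) (a d : ZMod c) (had : a * d = 1)
    (haN : a * N = N) :
    ∑ m ∈ Finset.range N, ((a * (m : ZMod c)).val : ℤ) + N
      = ∑ m ∈ Finset.Icc 1 N, ((d * (m : ZMod c)).val : ℤ) := by
  have hda : d * a = 1 := by rw [mul_comm]; exact had
  have hdN : d * N = N := by rw [← haN, ← mul_assoc, hda, one_mul, haN]
  have hNv : (N : ZMod c).val = N := ZMod.val_natCast_of_lt hNc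
  have hinj : ∀ u v : ZMod c, u * v = 1 → Function.Bijective (fun x : ZMod c => v * x) := by
    intro u v huv
    refine ⟨fun x y h => ?_, fun y => ⟨u * y, ?_⟩⟩
    · have := congrArg (fun z => u * z) h
      simpa [← mul_assoc, huv] using this
    · simp [← mul_assoc, mul_comm v u, huv]
  -- subtraction
  have hsub : ∀ x : ZMod c, ((x - N).val : ℤ) = x.val - N + (if x.val < N then (c : ℤ) else 0) := by
    intro x
    have h := ZMod.val_add (x - (N : ZMod c)) (N : ZMod c)
    rw [sub_add_cancel, hNv] at h
    have h1 := ZMod.val_lt (x - (N : ZMod c))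
    have h2 := ZMod.val_lt x
    rcases lt_or_ge ((x - N).val + N) c with h3 | h3
    · rw [Nat.mod_eq_of_lt h3] at h
      split_ifs <;> omega
    · rw [Nat.mod_eq_sub_mod h3, Nat.mod_eq_of_lt (by omega)] at h
      split_ifs <;> omega
  have hadd : ∀ x : ZMod c, ((x + N).val : ℤ) = x.val + N - (if c ≤ x.val + N then (c : ℤ) else 0) := by
    intro x
    have h := ZMod.val_add x (N : ZMod c)
    rw [hNv] at h
    have h2 := ZMod.val_lt x
    rcases lt_or_ge (x.val + N) c with h3 | h3
    · rw [Nat.mod_eq_of_lt h3] at h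
      split_ifs <;> omega
    · rw [Nat.mod_eq_sub_mod h3, Nat.mod_eq_of_lt (by omega)] at h
      split_ifs <;> omega
  have hneg : ∀ x : ZMod c, x ≠ 0 → ((-x).val : ℤ) = c - x.val := by
    intro x hx
    have h2 := ZMod.val_lt x
    rw [ZMod.neg_val, if_neg hx]
    omega
  set Q : ℤ := ∑ x : ZMod c, (x.val : ℤ) with hQ
  have hQ' : ∀ u v : ZMod c, u * v = 1 → ∑ x : ZMod c, ((v * x).val : ℤ) = Q := by
    intro u v huv
    exact (hinj u v huv).sum_comp (fun x : ZMod c => (x.val : ℤ))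
  have hQ2 : 2 * Q = c * (c - 1) := by
    have e : ∑ x : ZMod c, ((-x).val : ℤ) = Q := 
      Equiv.sum_comp (Equiv.neg (ZMod c)) (fun x : ZMod c => (x.val : ℤ))
    have : ∑ x : ZMod c, (((-x).val : ℤ) + x.val) = ∑ x : ZMod c, ((c : ℤ) - if x = 0 then (c:ℤ) else 0) := by
      apply Finset.sum_congr rfl
      intro x _
      by_cases hx : x = 0
      · simp [hx]
      · rw [hneg x hx, if_neg hx]; ring
    rw [Finset.sum_add_distrib, e, Finset.sum_sub_distrib] at this
    simp [ZMod.card, -ZMod.natCast_val] at this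
    linarith
  -- main exchange
  have hS0 : ∑ x : ZMod c, ((a * x).val : ℤ) * x.val = ∑ x : ZMod c, ((d * x).val : ℤ) * x.val := by
    rw [← (hinj a d had).sum_comp (fun x : ZMod c => ((a * x).val : ℤ) * x.val)]
    apply Finset.sum_congr rfl
    intro x _
    rw [← mul_assoc, had, one_mul, mul_comm]
  have hS1 : ∑ x : ZMod c, ((a * x).val : ℤ) * (x - N).val
      = ∑ x : ZMod c, ((d * x).val : ℤ) * (x + N).val := by
    rw [← (hinj a d had).sum_comp (fun x : ZMod c => ((a * x).val : ℤ) * (x - N).val),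
      ← Equiv.sum_comp (Equiv.addRight (N : ZMod c))]
    apply Finset.sum_congr rfl
    intro x _
    simp only [Equiv.coe_addRight]
    rw [← mul_assoc, had, one_mul, mul_add, hdN, add_sub_cancel_right, mul_comm]
  have hA : ∑ x : ZMod c, ((a * x).val : ℤ) * (x - N).val =
      ∑ x : ZMod c, ((a * x).val : ℤ) * x.val - N * Q
        + c * ∑ x : ZMod c, (if x.val < N then ((a * x).val : ℤ) else 0) := by
    rw [← hQ' d a hda, Finset.mul_sum, Finset.mul_sum, ← Finset.sum_sub_distrib,
      ← Finset.sum_add_distrib]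
    apply Finset.sum_congr rfl
    intro x _
    rw [hsub]
    split_ifs <;> ring
  have hD : ∑ x : ZMod c, ((d * x).val : ℤ) * (x + N).val =
      ∑ x : ZMod c, ((d * x).val : ℤ) * x.val + N * Q
        - c * ∑ x : ZMod c, (if c ≤ x.val + N then ((d * x).val : ℤ) else 0) := by
    rw [← hQ' a d had, Finset.mul_sum, Finset.mul_sum, ← Finset.sum_add_distrib,
      ← Finset.sum_sub_distrib]
    apply Finset.sum_congr rfl
    intro x _
    rw [hadd]
    split_ifs <;> ring
  have hA2 : ∑ x : ZMod c, (if x.val < N then ((a * x).val : ℤ) else 0)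
      = ∑ m ∈ Finset.range N, ((a * (m : ZMod c)).val : ℤ) := by
    rw [← Finset.sum_filter]
    refine Finset.sum_nbij' (fun x => x.val) (fun m => (m : ZMod c)) ?_ ?_ ?_ ?_ ?_
    · intro x hx; simpa using hx
    · intro m hm
      have hm := Finset.mem_range.1 hm
      simp [ZMod.val_natCast_of_lt (hm.trans hNc), hm]
    · intro x _; simp
    · intro m hm
      have hm := Finset.mem_range.1 hm
      exact ZMod.val_natCast_of_lt (hm.trans hNc)
    · intro x _; simp
  have hD2 : ∑ x : ZMod c, (if c ≤ x.val + N then ((d * x).val : ℤ) else 0)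
      = ∑ m ∈ Finset.Icc 1 N, ((c : ℤ) - ((d * (m : ZMod c)).val : ℤ)) := by
    rw [← Finset.sum_filter]
    refine Finset.sum_nbij' (fun x => c - x.val) (fun m => -(m : ZMod c)) ?_ ?_ ?_ ?_ ?_
    · intro x hx
      have h2 := ZMod.val_lt x
      simp at hx ⊢; omega
    · intro m hm
      have hm := Finset.mem_Icc.1 hm
      have hv := ZMod.val_natCast_of_lt (hm.2.trans_lt hNc)
      have h0 : (m : ZMod c) ≠ 0 := by
        intro h; rw [h] at hv; simp at hv; omega
      have := hneg _ h0
      simp; omega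
    · intro x _
      have h2 := ZMod.val_lt x
      simp [Nat.cast_sub h2.le]
    · intro m hm
      have hm := Finset.mem_Icc.1 hm
      have hv := ZMod.val_natCast_of_lt (hm.2.trans_lt hNc)
      have h0 : (m : ZMod c) ≠ 0 := by
        intro h; rw [h] at hv; simp at hv; omega
      have := hneg _ h0
      omega
    · intro x hx
      have h2 := ZMod.val_lt x
      have hx0 : x ≠ 0 := by
        rintro rfl
        simp at hx; omega
      have hdx : d * x ≠ 0 := by
        intro h
        apply hx0
        have := congrArg (fun z => a * z) h
        simpa [← mul_assoc, had] using this
      have e : d * ((c - x.val : ℕ) : ZMod c) = -(d * x) := by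
        rw [Nat.cast_sub h2.le]; simp
      rw [e, hneg _ hdx]; ring
  rw [hA2] at hA
  rw [hD2, Finset.sum_sub_distrib] at hD
  simp [-ZMod.natCast_val] at hD
  have hc0 : (c : ℤ) ≠ 0 := by exact_mod_cast (NeZero.ne c)
  apply mul_left_cancel₀ hc0
  have h2 : N * (2 * Q) = (N : ℤ) * (c * (c - 1)) := by rw [hQ2]
  linarith
/-- row-by-row count -/
lemma count_rows (a c : ℤ) (hc : 0 < c) (N : ℕ) :
    (Set.ncard {p : ℤ × ℤ | 0 < p.2 ∧ c * p.1 < (a - 1) * p.2 ∧ a * p.2 - N < c * p.1} : ℤ)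
      = ∑ q ∈ Finset.Ico 1 N, (-(((1 - a) * (q:ℤ)) / c) - (a * (q:ℤ) - N) / c - 1) := by
  have hset : {p : ℤ × ℤ | 0 < p.2 ∧ c * p.1 < (a - 1) * p.2 ∧ a * p.2 - N < c * p.1}
      = (((Finset.Ico 1 N).sigma (fun q : ℕ => Finset.Ioo ((a * (q:ℤ) - N) / c)
          (-(((1 - a) * (q:ℤ)) / c)))).image (fun s => (s.2, (s.1 : ℤ))) : Finset (ℤ × ℤ)) := by
    have key1 : ∀ p q : ℤ, (a * q - N) / c < p ↔ a * q - N < c * p := by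
      intro p q
      rw [Int.ediv_lt_iff_lt_mul hc, mul_comm p c]
    have key2 : ∀ p q : ℤ, p < -(((1 - a) * q) / c) ↔ c * p < (a - 1) * q := by
      intro p q
      rw [lt_neg, Int.ediv_lt_iff_lt_mul hc]
      constructor <;> intro h <;> linarith
    ext ⟨p, q⟩
    simp only [Finset.coe_image, Set.mem_image, Finset.mem_coe, Finset.mem_sigma, Finset.mem_Ico,
      Finset.mem_Ioo, Sigma.exists, Prod.mk.injEq, key1, key2]
    constructor
    · rintro ⟨h1, h2, h3⟩
      simp only at h1 h2 h3
      refine ⟨q.toNat, p, ?_, rfl, Int.toNat_of_nonneg h1.le⟩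
      rw [Int.toNat_of_nonneg h1.le]
      have : q < N := by linarith
      exact ⟨⟨by omega, by omega⟩, h3, h2⟩
    · rintro ⟨m, p', ⟨⟨h1, h2⟩, h3, h4⟩, rfl, rfl⟩
      exact ⟨by simpa using by omega, h4, h3⟩
  rw [hset, Set.ncard_coe_finset, Finset.card_image_of_injective, Finset.card_sigma]
  · push_cast
    apply Finset.sum_congr rfl
    intro q hq
    have hq := Finset.mem_Ico.1 hq
    rw [Int.card_Ioo]
    have hlt : (a * (q:ℤ) - N) / c < -(((1 - a) * (q:ℤ)) / c) := by
      have h1 := Int.mul_ediv_add_emod (a * (q:ℤ) - N) c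
      have h2 := Int.mul_ediv_add_emod ((1 - a) * (q:ℤ)) c
      have h3 := Int.emod_nonneg (a * (q:ℤ) - N) hc.ne'
      have h4 := Int.emod_nonneg ((1 - a) * (q:ℤ)) hc.ne'
      have h5 : (q:ℤ) < N := by exact_mod_cast hq.2
      apply lt_of_mul_lt_mul_left _ hc.le
      linarith
    omega
  · rintro ⟨m, p⟩ ⟨m', p'⟩ h
    simp at h
    obtain ⟨rfl, rfl⟩ := h
    rfl

lemma emod_neg' (c x : ℤ) (hc : 0 < c) : (-x) % c = (if c ∣ x then 0 else c) - x % c := by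
  split_ifs with h
  · rw [Int.emod_eq_zero_of_dvd h, Int.emod_eq_zero_of_dvd ((dvd_neg).2 h)]; rfl
  · have h1 := Int.emod_pos_of_not_dvd h
    have h2 := Int.emod_lt_of_pos x hc
    have : -x = (c - x % c) + c * (-(x / c) - 1) := by
      have := Int.mul_ediv_add_emod x c
      linarith
    rw [this, Int.add_mul_emod_self_left, Int.emod_eq_of_lt (by omega) (by omega)]

lemma sum_reflect_Ico (N : ℕ) (f : ℕ → ℤ) :
    ∑ q ∈ Finset.Ico 1 N, f q = ∑ q ∈ Finset.Ico 1 N, f (N - q) := by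
  refine Finset.sum_nbij' (fun q => N - q) (fun q => N - q) ?_ ?_ ?_ ?_ ?_ <;>
    intro q hq <;> simp only [Finset.mem_Ico] at hq ⊢
  · omega
  · omega
  · omega
  · omega
  · congr 1; omega

lemma sum_frac (a c : ℤ) (hc : 0 < c) (N k : ℕ) (hN : 0 < N)
    (hk : (N : ℤ) * (Int.gcd c (a - 1)) = c * k) :
    2 * ∑ q ∈ Finset.Ico 1 N, ((1 - a) * (q:ℤ)) % c = c * (N - k) := by
  set l := Int.gcd c (a - 1) with hl
  have hlpos : 0 < l := Int.gcd_pos_of_ne_zero_left _ hc.ne'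
  obtain ⟨e, he⟩ : (l : ℤ) ∣ c := Int.gcd_dvd_left ..
  obtain ⟨f, hf⟩ : (l : ℤ) ∣ a - 1 := Int.gcd_dvd_right ..
  have hl0 : (l : ℤ) ≠ 0 := by exact_mod_cast hlpos.ne'
  have hNe : (N : ℤ) = e * k := by
    apply mul_right_cancel₀ hl0
    rw [hk, he]; ring
  have hdN : c ∣ (1 - a) * N := ⟨-(f * k), by
    rw [hNe, show 1 - a = -(l * f) by rw [← hf]; ring]
    linear_combination (f * k) * he⟩
  have hepos : 0 < e := by
    by_contra h
    have : (l:ℤ) * e ≤ 0 := mul_nonpos_of_nonneg_of_nonpos (by positivity) (by omega)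
    omega
  have hcop : IsCoprime e f := by
    rw [Int.isCoprime_iff_gcd_eq_one]
    have : l = l * Int.gcd e f := by
      conv_lhs => rw [hl, he, hf, Int.gcd_mul_left]
      simp
    exact Nat.eq_of_mul_eq_mul_left hlpos (by omega)
  have hiff : ∀ q : ℤ, c ∣ (1 - a) * q ↔ e ∣ q := by
    intro q
    rw [show (1 - a) * q = -(l * (f * q)) by rw [← mul_assoc, ← hf]; ring, dvd_neg, he,
      mul_dvd_mul_iff_left hl0]
    exact ⟨fun h => hcop.dvd_of_dvd_mul_left h, fun h => h.mul_left f⟩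
  have h1 : ∑ q ∈ Finset.Ico 1 N, ((1 - a) * (q:ℤ)) % c
      = ∑ q ∈ Finset.Ico 1 N, ((if c ∣ (1 - a) * (q:ℤ) then 0 else c) - ((1 - a) * (q:ℤ)) % c) := by
    rw [sum_reflect_Ico]
    apply Finset.sum_congr rfl
    intro q hq
    have hq := Finset.mem_Ico.1 hq
    rw [← emod_neg' c _ hc, Nat.cast_sub hq.2.le]
    obtain ⟨g, hg⟩ := hdN
    rw [show (1 - a) * ((N:ℤ) - q) = -((1 - a) * q) + c * g by rw [← hg]; ring,
      Int.add_mul_emod_self_left]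
  rw [Finset.sum_sub_distrib] at h1
  have h2 : ∑ q ∈ Finset.Ico 1 N, (if c ∣ (1 - a) * (q:ℤ) then 0 else c) = c * (N - k) := by
    have hIoc : Finset.Ioc 0 N = insert N (Finset.Ico 1 N) := by ext; simp; omega
    have h3 : ∑ q ∈ Finset.Ioc 0 N, (if c ∣ (1 - a) * (q:ℤ) then 0 else c)
       = ∑ q ∈ Finset.Ico 1 N, (if c ∣ (1 - a) * (q:ℤ) then 0 else c) := by
      rw [hIoc, Finset.sum_insert (by simp), if_pos hdN, zero_add]
    rw [← h3]
    have h4 : ∀ q ∈ Finset.Ioc 0 N, (if c ∣ (1 - a) * (q:ℤ) then 0 else c)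
        = c - c * (if e.toNat ∣ q then 1 else 0) := by
      intro q _
      have : c ∣ (1 - a) * (q:ℤ) ↔ e.toNat ∣ q := by
        rw [hiff, ← Int.natCast_dvd_natCast, Int.toNat_of_nonneg hepos.le]
      simp only [this]
      split_ifs <;> ring
    have h5 : N / e.toNat = k := by
      apply Nat.div_eq_of_eq_mul_right (by omega)
      zify
      rw [Int.toNat_of_nonneg hepos.le, hNe]
    rw [Finset.sum_congr rfl h4, Finset.sum_sub_distrib, ← Finset.mul_sum, Finset.sum_boole,
      Nat.Ioc_filter_dvd_card_eq_div, h5]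
    simp
    ring
  linarith

lemma core_s10 (a b c d : ℤ) (hdet : a * d - b * c = 1) (hc : 0 < c) (N k : ℕ) (hN : 0 < N)
    (hNc : (N : ℤ) < c) (hk : (N : ℤ) * (Int.gcd c (a - 1)) = c * k) :
    2 * c * (Set.ncard {p : ℤ × ℤ | 0 < p.2 ∧ c * p.1 < (a - 1) * p.2 ∧ a * p.2 - N < c * p.1} : ℤ)
      = N * (N + 1 + c - Int.gcd c (a - 1)) - 2 * ∑ m ∈ Finset.Icc 1 N, ((m : ℤ) * d) % c := by
  have hdN : c ∣ (a - 1) * N := by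
    have h1 : (Int.gcd c (a - 1) : ℤ) ∣ a - 1 := Int.gcd_dvd_right ..
    obtain ⟨f, hf⟩ := h1
    refine ⟨f * k, ?_⟩
    rw [hf]; linear_combination f * hk
  have hcop : IsCoprime c a := ⟨-b, d, by linarith⟩
  have hA : ∑ q ∈ Finset.Ico 1 N, (a * (q:ℤ)) % c + N = ∑ m ∈ Finset.Icc 1 N, ((m : ℤ) * d) % c := by
    lift c to ℕ using hc.le
    have : NeZero c := ⟨by rintro rfl; simp at hc⟩
    have := dual c N hN (by exact_mod_cast hNc) (a : ZMod c) (d : ZMod c) ?_ ?_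
    · rw [Finset.range_eq_Ico, Finset.sum_eq_sum_Ico_succ_bot hN] at this
      simp only [Nat.cast_zero, mul_zero, ZMod.val_zero, zero_add] at this
      convert this using 2
      · apply Finset.sum_congr rfl
        intro q _
        rw [← ZMod.val_intCast]; push_cast; rfl
      · rw [← ZMod.val_intCast]; push_cast; rw [mul_comm]
    · have : ((a * d - b * c : ℤ) : ZMod c) = 1 := by rw [hdet]; simp
      simpa using this
    · have := (ZMod.intCast_zmod_eq_zero_iff_dvd _ _).2 hdN
      push_cast at this
      linear_combination this
  have hB : ∑ q ∈ Finset.Ico 1 N, (a * (q:ℤ) - N) % c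
      = ∑ q ∈ Finset.Ico 1 N, (c - (a * (q:ℤ)) % c) := by
    rw [sum_reflect_Ico]
    apply Finset.sum_congr rfl
    intro q hq
    have hq := Finset.mem_Ico.1 hq
    have hnd : ¬ c ∣ a * q := by
      intro h
      have := Int.le_of_dvd (by omega) (hcop.dvd_of_dvd_mul_left h)
      omega
    have := emod_neg' c (a * q) hc
    rw [if_neg hnd] at this
    rw [← this, Nat.cast_sub hq.2.le]
    obtain ⟨g, hg⟩ := hdN
    rw [show a * ((N:ℤ) - q) - N = -(a * q) + c * g by rw [← hg]; ring,
      Int.add_mul_emod_self_left]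
  have hC := sum_frac a c hc N k hN hk
  have hG : 2 * ∑ q ∈ Finset.Ico 1 N, ((N:ℤ) - q) = N * (N - 1) := by
    have h1 : ∑ q ∈ Finset.Ico 1 N, ((N:ℤ) - q) = ∑ q ∈ Finset.Ico 1 N, (q:ℤ) := by
      rw [sum_reflect_Ico N (fun q => (q:ℤ))]
      apply Finset.sum_congr rfl
      intro q hq
      have hq := Finset.mem_Ico.1 hq
      rw [Nat.cast_sub hq.2.le]
    have h2 : ∑ q ∈ Finset.Ico 1 N, ((N:ℤ) - q) + ∑ q ∈ Finset.Ico 1 N, (q:ℤ) = N * (N - 1) := by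
      rw [← Finset.sum_add_distrib]
      simp [Nat.cast_sub (show 1 ≤ N from hN)]
      ring
    linarith
  have hcard : ∑ q ∈ Finset.Ico 1 N, c = (N - 1) * c := by
    simp [Nat.cast_sub (show 1 ≤ N from hN)]
  have hrow : c * (Set.ncard {p : ℤ × ℤ | 0 < p.2 ∧ c * p.1 < (a - 1) * p.2 ∧ a * p.2 - N < c * p.1} : ℤ)
      = ∑ q ∈ Finset.Ico 1 N, ((N:ℤ) - q) + ∑ q ∈ Finset.Ico 1 N, ((1 - a) * (q:ℤ)) % c
        + ∑ q ∈ Finset.Ico 1 N, (a * (q:ℤ) - N) % c - ∑ q ∈ Finset.Ico 1 N, c := by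
    rw [count_rows a c hc N, Finset.mul_sum, ← Finset.sum_add_distrib, ← Finset.sum_add_distrib,
      ← Finset.sum_sub_distrib]
    apply Finset.sum_congr rfl
    intro q _
    have h1 := Int.mul_ediv_add_emod (a * (q:ℤ) - N) c
    have h2 := Int.mul_ediv_add_emod ((1 - a) * (q:ℤ)) c
    linarith
  rw [Finset.sum_sub_distrib] at hB
  linarith

/-- **Theorem (Statement 10).** Closed form for the number of interior lattice points
of `T_{γ,x}`. -/
theorem statement10 (a b c d : ℤ) (hdet : a * d - b * c = 1) (hc : 0 < c)
    (x₁ : ℚ) (hx : ∃ n : ℤ, x₁ = (n : ℚ) / (Int.gcd c (a - 1) : ℚ)) (hx' : x₁.den ≠ 1)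
    (N : ℕ) (hN : (N : ℚ) = c * (x₁ - ⌊x₁⌋)) :
    0 < N ∧
    (latticeCount (interior (Int.fract (x₁ : ℝ) • Tri a c)) : ℝ)
      = Int.fract (x₁ : ℝ) / 2 *
          ((c : ℝ) * Int.fract (x₁ : ℝ) + 1 + (c : ℝ) - (Int.gcd c (a - 1) : ℝ))
        - ∑ m ∈ Finset.Icc 1 N, Int.fract ((m : ℝ) * d / c) := by
  have hcR : (0:ℝ) < c := by exact_mod_cast hc
  have hcQ : (0:ℚ) < c := by exact_mod_cast hc
  obtain ⟨n, hn⟩ := hx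
  have hlpos : 0 < Int.gcd c (a - 1) := Int.gcd_pos_of_ne_zero_left _ hc.ne'
  have hlQ : (0:ℚ) < (Int.gcd c (a - 1) : ℚ) := by exact_mod_cast hlpos
  have hfpos : 0 < x₁ - ⌊x₁⌋ := by
    rcases (sub_nonneg.2 (Int.floor_le x₁)).lt_or_eq with h | h
    · exact h
    · exfalso
      apply hx'
      have : x₁ = ((⌊x₁⌋ : ℤ) : ℚ) := by linarith
      rw [this]; simp
  have hflt : x₁ - ⌊x₁⌋ < 1 := by linarith [Int.lt_floor_add_one x₁]
  have hNpos : 0 < N := by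
    have : (0:ℚ) < N := by rw [hN]; positivity
    exact_mod_cast this
  have hNc : (N : ℤ) < c := by
    have : (N:ℚ) < c := by rw [hN]; nlinarith
    exact_mod_cast this
  refine ⟨hNpos, ?_⟩
  have hkq : ((n - ⌊x₁⌋ * (Int.gcd c (a - 1) : ℤ) : ℤ) : ℚ) = (x₁ - ⌊x₁⌋) * (Int.gcd c (a - 1) : ℚ) := by
    have : x₁ * (Int.gcd c (a - 1) : ℚ) = n := by
      conv_lhs => rw [hn]
      field_simp
    push_cast
    linarith
  have hkpos : 0 < n - ⌊x₁⌋ * (Int.gcd c (a - 1) : ℤ) := by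
    have : (0:ℚ) < ((n - ⌊x₁⌋ * (Int.gcd c (a - 1) : ℤ) : ℤ) : ℚ) := by rw [hkq]; positivity
    exact_mod_cast this
  obtain ⟨k, hk⟩ := Int.eq_ofNat_of_zero_le hkpos.le
  rw [hk] at hkq
  have hk' : (N : ℤ) * (Int.gcd c (a - 1)) = c * k := by
    have : (N : ℚ) * (Int.gcd c (a - 1)) = c * k := by
      rw [hN]; push_cast at hkq; rw [hkq]; ring
    exact_mod_cast this
  have hcore := core_s10 a b c d hdet hc N k hNpos hNc hk'
  have ht : Int.fract (x₁ : ℝ) = ((x₁ - ⌊x₁⌋ : ℚ) : ℝ) := by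
    rw [Int.fract, Rat.floor_cast]; push_cast; rfl
  have htpos : 0 < Int.fract (x₁ : ℝ) := by rw [ht]; exact_mod_cast hfpos
  have hNt : (N : ℝ) = c * Int.fract (x₁ : ℝ) := by
    rw [ht]; exact_mod_cast hN
  rw [interior_tri a c hc _ htpos]
  set t := Int.fract (x₁ : ℝ) with htdef
  have hset : latticeCount {p : ℝ × ℝ | 0 < p.2 ∧ 0 < ((a:ℝ) - 1) * p.2 - c * p.1 ∧
      -(t * c) < (c * p.1 - a * p.2)} = Set.ncard {p : ℤ × ℤ | 0 < p.2 ∧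
        c * p.1 < (a - 1) * p.2 ∧ a * p.2 - N < c * p.1} := by
    unfold latticeCount
    congr 1
    ext ⟨p, q⟩
    simp only [Set.mem_ofPred_eq]
    refine and_congr (by exact_mod_cast Iff.rfl) (and_congr ?_ ?_)
    · rw [sub_pos]; exact_mod_cast Iff.rfl
    · rw [mul_comm t, ← hNt]
      rw [show (-(N:ℝ) < c * p - a * q) ↔ ((a:ℝ) * q - N < c * p) by
        constructor <;> intro h <;> linarith]
      exact_mod_cast Iff.rfl
  rw [hset]
  have hsum : ∑ m ∈ Finset.Icc 1 N, Int.fract ((m : ℝ) * d / c)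
      = (∑ m ∈ Finset.Icc 1 N, (((m : ℤ) * d) % c : ℤ) : ℤ) / (c : ℝ) := by
    push_cast
    rw [Finset.sum_div]
    apply Finset.sum_congr rfl
    intro m _
    have h1 := Int.mul_ediv_add_emod ((m : ℤ) * d) c
    have h3 := Int.emod_nonneg ((m : ℤ) * d) hc.ne'
    have h4 := Int.emod_lt_of_pos ((m : ℤ) * d) hc
    have h1R : (c:ℝ) * (((m : ℤ) * d) / c : ℤ) + (((m : ℤ) * d) % c : ℤ) = (m:ℝ) * d := by
      exact_mod_cast h1
    have h3R : (0:ℝ) ≤ (((m : ℤ) * d) % c : ℤ) := by exact_mod_cast h3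
    have h4R : ((((m : ℤ) * d) % c : ℤ) : ℝ) < c := by exact_mod_cast h4
    rw [Int.fract_eq_iff]
    refine ⟨by positivity, by rw [div_lt_one hcR]; exact h4R, ((m : ℤ) * d) / c, ?_⟩
    rw [← h1R]
    field_simp
    ring
  rw [hsum]
  have hcoreR := congrArg (fun z : ℤ => (z : ℝ)) hcore
  simp only [Int.cast_mul, Int.cast_sub, Int.cast_add, Int.cast_natCast, Int.cast_ofNat,
    Int.cast_one] at hcoreR
  generalize (∑ m ∈ Finset.Icc 1 N, (((m : ℤ) * d) % c : ℤ) : ℤ) = S at *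
  have h2 : (2 * (c:ℝ)) ≠ 0 := by positivity
  apply mul_left_cancel₀ h2
  rw [hcoreR, hNt]
  field_simp
end
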